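/- arXiv:2001.02668 — 4 statements merged into one kernel-verified Lean document; each statement's English description precedes it below -/
import Mathlib

section
/- Proposition 1 (dimension bound on the auxiliary system). Let N⁰ and N¹ be quantum channels from A (dimension d_A) to B (dimension d_B) with Kraus operators {N_k⁰}_{k=1}^K and {N_k¹}_{k=1}^K. For every fixed positive integer d_R, the supremum of ‖N⁰†(P⁰) + N¹†(P¹)‖ over all positive integers d_{E′} and all complex (d_R d_B d_{E′})×(d_R d_B) matrices P⁰, P¹ satisfying P⁰†P⁰ + P¹†P¹ = I_{d_R d_B} is equal to the same supremum restricted to d_{E′} = 2 d_R d_B². -/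
open scoped Kronecker Matrix

/-- The ℓ²→ℓ² operator norm of a complex matrix. -/
noncomputable def opNorm {m n : Type*} [Fintype m] [Fintype n] [DecidableEq n]
    (M : Matrix m n ℂ) : ℝ :=
  ‖LinearMap.toContinuousLinearMap (Matrix.toEuclideanLin M)‖

/-- The extended adjoint `N†(P) = ∑ₖ (I ⊗ Nₖᴴ ⊗ I) P (I ⊗ Nₖ)` of a channel with
Kraus operators `N k`, applied to a `(d_R·d_B·d_E') × (d_R·d_B)` matrix `P`. -/
noncomputable def chAdj {dA dB dR dE : ℕ} {ι : Type*} [Fintype ι]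
    (N : ι → Matrix (Fin dB) (Fin dA) ℂ)
    (P : Matrix (Fin dR × Fin dB × Fin dE) (Fin dR × Fin dB) ℂ) :
    Matrix (Fin dR × Fin dA × Fin dE) (Fin dR × Fin dA) ℂ :=
  ∑ k, ((1 : Matrix (Fin dR) (Fin dR) ℂ) ⊗ₖ ((N k)ᴴ ⊗ₖ (1 : Matrix (Fin dE) (Fin dE) ℂ))) *
    P * ((1 : Matrix (Fin dR) (Fin dR) ℂ) ⊗ₖ N k)

/-- The coherent-discrimination success probability
`p_coh(N⁰,N¹) = [ (1/2) · sup ‖ N⁰†(P⁰) + N¹†(P¹) ‖ ]²`, where the supremum is over all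
positive integers `d_R, d_E'` and all matrices `P⁰, P¹` with `P⁰ᴴP⁰ + P¹ᴴP¹ = I`. -/
noncomputable def pcoh {dA dB : ℕ} {ι : Type*} [Fintype ι]
    (N0 N1 : ι → Matrix (Fin dB) (Fin dA) ℂ) : ℝ :=
  ((1/2) * sSup {x : ℝ | ∃ (dR dE : ℕ), 0 < dR ∧ 0 < dE ∧
    ∃ P0 P1 : Matrix (Fin dR × Fin dB × Fin dE) (Fin dR × Fin dB) ℂ,
      P0ᴴ * P0 + P1ᴴ * P1 = 1 ∧ x = opNorm (chAdj N0 P0 + chAdj N1 P1)})^2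

/-- If `A` has at most `card f` columns, some matrix `V` with `f` rows acts isometrically on
the column space of `A`. -/
lemma Matrix.exists_conjTranspose_mul_self_mul_eq {e f ι : Type*} [Fintype e] [Fintype f]
    [Fintype ι] [DecidableEq f] (A : Matrix e ι ℂ) (h : Fintype.card ι ≤ Fintype.card f) :
    ∃ V : Matrix f e ℂ, Vᴴ * V * A = A := by
  let w : ι → EuclideanSpace ℂ e := fun j => WithLp.toLp 2 (fun x => A x j)
  let S := Submodule.span ℂ (Set.range w)
  let b := stdOrthonormalBasis ℂ S
  have hcard : Fintype.card (Fin (Module.finrank ℂ S)) ≤ Fintype.card f := by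
    rw [Fintype.card_fin]
    exact (finrank_range_le_card w).trans h
  obtain ⟨g⟩ := Function.Embedding.nonempty_of_card_le hcard
  let B : Matrix e (Fin (Module.finrank ℂ S)) ℂ := Matrix.of fun x i => (b i : EuclideanSpace ℂ e) x
  let J : Matrix f (Fin (Module.finrank ℂ S)) ℂ := (1 : Matrix f f ℂ).submatrix id g
  have hJ : Jᴴ * J = 1 := by
    ext i j
    simp [J, Matrix.mul_apply, Matrix.one_apply]
  have hB : B * (Bᴴ * A) = A := by
    ext x j
    have hw : w j ∈ S := Submodule.subset_span ⟨j, rfl⟩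
    have h1 := congrArg (fun s : S => (s : EuclideanSpace ℂ e) x) (b.sum_repr ⟨w j, hw⟩)
    simp only [b.repr_apply_apply, Submodule.coe_inner, Submodule.coe_sum, Submodule.coe_smul,
      WithLp.ofLp_sum, WithLp.ofLp_smul, Finset.sum_apply, Pi.smul_apply, smul_eq_mul,
      PiLp.inner_apply] at h1
    rw [Matrix.mul_apply]
    refine Eq.trans (Finset.sum_congr rfl fun i _ => ?_) h1
    rw [Matrix.mul_apply, mul_comm]
    congr 1
    refine Finset.sum_congr rfl fun y _ => ?_
    simp [B, w, mul_comm]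
  refine ⟨J * Bᴴ, ?_⟩
  rw [Matrix.conjTranspose_mul, Matrix.conjTranspose_conjTranspose]
  calc B * Jᴴ * (J * Bᴴ) * A = B * ((Jᴴ * J) * (Bᴴ * A)) := by simp only [Matrix.mul_assoc]
    _ = A := by rw [hJ, Matrix.one_mul, hB]

open scoped Matrix.Norms.L2Operator in
lemma opNorm_eq_of_conjTranspose_mul_self_eq {m m' n : Type*} [Fintype m] [Fintype m'] [Fintype n]
    [DecidableEq m] [DecidableEq m'] [DecidableEq n] {M : Matrix m n ℂ} {M' : Matrix m' n ℂ}
    (h : M'ᴴ * M' = Mᴴ * M) : opNorm M' = opNorm M := by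
  have key : ‖M'‖ * ‖M'‖ = ‖M‖ * ‖M‖ := by
    rw [← Matrix.l2_opNorm_conjTranspose_mul_self, h, Matrix.l2_opNorm_conjTranspose_mul_self]
  exact (mul_self_inj (norm_nonneg _) (norm_nonneg _)).1 key

/-- The reordering of tensor factors moving the middle one to the end. -/
def middleLast (r x e : Type*) : r × x × e ≃ (r × e) × x where
  toFun p := ((p.1, p.2.2), p.2.1)
  invFun q := (q.1.1, q.2, q.1.2)

/-- A matrix `V` on the outer two factors together with `N` on the middle factor. -/
def outerKronecker {r r' x x' e e' : Type*} (V : Matrix (r × e) (r' × e') ℂ) (N : Matrix x x' ℂ) :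
    Matrix (r × x × e) (r' × x' × e') ℂ :=
  (V ⊗ₖ N).submatrix (middleLast r x e) (middleLast r' x' e')

section outerKronecker

variable {r r' r'' x x' x'' e e' e'' : Type*}

lemma outerKronecker_mul [Fintype r'] [Fintype x'] [Fintype e']
    (V : Matrix (r × e) (r' × e') ℂ) (N : Matrix x x' ℂ)
    (V' : Matrix (r' × e') (r'' × e'') ℂ) (N' : Matrix x' x'' ℂ) :
    outerKronecker V N * outerKronecker V' N' = outerKronecker (V * V') (N * N') := by
  rw [outerKronecker, outerKronecker, Matrix.submatrix_mul_equiv, ← Matrix.mul_kronecker_mul]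
  rfl

lemma conjTranspose_outerKronecker (V : Matrix (r × e) (r' × e') ℂ) (N : Matrix x x' ℂ) :
    (outerKronecker V N)ᴴ = outerKronecker Vᴴ Nᴴ := by
  rw [outerKronecker, Matrix.conjTranspose_submatrix, Matrix.conjTranspose_kronecker]
  rfl

lemma one_kronecker_kronecker_one [DecidableEq r] [DecidableEq e] (N : Matrix x x' ℂ) :
    (1 : Matrix r r ℂ) ⊗ₖ (N ⊗ₖ (1 : Matrix e e ℂ)) = outerKronecker 1 N := by
  ext ⟨i, a, k⟩ ⟨i', a', k'⟩
  by_cases h : i = i' <;> by_cases h' : k = k' <;>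
    simp [outerKronecker, middleLast, h, h']

lemma outerKronecker_one_mul_apply [Fintype r'] [Fintype x] [Fintype e'] [DecidableEq x]
    {c : Type*} (V : Matrix (r × e) (r' × e') ℂ) (P : Matrix (r' × x × e') c ℂ)
    (i : r) (a : x) (k : e) (j : c) :
    (outerKronecker V (1 : Matrix x x ℂ) * P) (i, a, k) j =
      ∑ q, V (i, k) q * P (q.1, a, q.2) j := by
  rw [Matrix.mul_apply, ← (middleLast r' x e').symm.sum_comp, Fintype.sum_prod_type]
  simp [outerKronecker, middleLast, Matrix.one_apply]

end outerKronecker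

lemma chAdj_outerKronecker_mul {dA dB dR dE dF : ℕ} {ι : Type*} [Fintype ι]
    (N : ι → Matrix (Fin dB) (Fin dA) ℂ)
    (V : Matrix (Fin dR × Fin dF) (Fin dR × Fin dE) ℂ)
    (P : Matrix (Fin dR × Fin dB × Fin dE) (Fin dR × Fin dB) ℂ) :
    chAdj N (outerKronecker V (1 : Matrix (Fin dB) (Fin dB) ℂ) * P) =
      outerKronecker V (1 : Matrix (Fin dA) (Fin dA) ℂ) * chAdj N P := by
  simp only [chAdj, Matrix.mul_sum, one_kronecker_kronecker_one]
  refine Finset.sum_congr rfl fun k _ => ?_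
  simp only [← Matrix.mul_assoc, outerKronecker_mul, Matrix.one_mul, Matrix.mul_one]

/-- Compressing the reference and auxiliary factors jointly reduces the auxiliary dimension
without changing the normalisation or the objective. -/
lemma exists_opNorm_chAdj_eq {dA dB dR dE dF : ℕ} {ι : Type*} [Fintype ι]
    (N0 N1 : ι → Matrix (Fin dB) (Fin dA) ℂ) (hF : 2 * dB ^ 2 ≤ dF)
    (P0 P1 : Matrix (Fin dR × Fin dB × Fin dE) (Fin dR × Fin dB) ℂ) :
    ∃ Q0 Q1 : Matrix (Fin dR × Fin dB × Fin dF) (Fin dR × Fin dB) ℂ,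
      Q0ᴴ * Q0 = P0ᴴ * P0 ∧ Q1ᴴ * Q1 = P1ᴴ * P1 ∧
        opNorm (chAdj N0 Q0 + chAdj N1 Q1) = opNorm (chAdj N0 P0 + chAdj N1 P1) := by
  let cols (P : Matrix (Fin dR × Fin dB × Fin dE) (Fin dR × Fin dB) ℂ) :
      Matrix (Fin dR × Fin dE) (Fin dB × Fin dR × Fin dB) ℂ :=
    Matrix.of fun p q => P (p.1, q.1, p.2) q.2
  obtain ⟨V, hV⟩ := Matrix.exists_conjTranspose_mul_self_mul_eq (f := Fin dR × Fin dF)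
    (Matrix.fromCols (cols P0) (cols P1)) (by
      simp only [Fintype.card_sum, Fintype.card_prod, Fintype.card_fin]
      nlinarith [Nat.mul_le_mul_left dR hF])
  rw [Matrix.mul_fromCols, Matrix.fromCols_inj.eq_iff] at hV
  have fixed (P : Matrix (Fin dR × Fin dB × Fin dE) (Fin dR × Fin dB) ℂ)
      (hP : Vᴴ * V * cols P = cols P) :
      outerKronecker (Vᴴ * V) (1 : Matrix (Fin dB) (Fin dB) ℂ) * P = P := by
    ext ⟨i, a, k⟩ j
    rw [outerKronecker_one_mul_apply]
    exact congrFun (congrFun hP (i, k)) (a, j)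
  have gram {x c : Type} [Fintype x] [DecidableEq x] (P : Matrix (Fin dR × x × Fin dE) c ℂ)
      (hP : outerKronecker (Vᴴ * V) (1 : Matrix x x ℂ) * P = P) :
      (outerKronecker V (1 : Matrix x x ℂ) * P)ᴴ * (outerKronecker V (1 : Matrix x x ℂ) * P) =
        Pᴴ * P := by
    rw [Matrix.conjTranspose_mul, Matrix.mul_assoc, ← Matrix.mul_assoc _ _ P,
      conjTranspose_outerKronecker, outerKronecker_mul, Matrix.conjTranspose_one,
      Matrix.one_mul, hP]
  have h0 := fixed P0 hV.1
  have h1 := fixed P1 hV.2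
  refine ⟨outerKronecker V (1 : Matrix (Fin dB) (Fin dB) ℂ) * P0,
    outerKronecker V (1 : Matrix (Fin dB) (Fin dB) ℂ) * P1, gram P0 h0, gram P1 h1, ?_⟩
  rw [chAdj_outerKronecker_mul, chAdj_outerKronecker_mul, ← Matrix.mul_add]
  refine opNorm_eq_of_conjTranspose_mul_self_eq (gram _ ?_)
  rw [Matrix.mul_add, ← chAdj_outerKronecker_mul, ← chAdj_outerKronecker_mul, h0, h1]

/-- Proposition 1 (dimension bound on the auxiliary system): for fixed `d_R`, the supremum of
`‖N⁰†(P⁰) + N¹†(P¹)‖` over all positive integers `d_E'` and admissible `P⁰, P¹` equals the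
same supremum restricted to `d_E' = 2 d_R d_B²`. -/
theorem dim_bound_aux_system {dA dB K : ℕ}
    (N0 N1 : Fin K → Matrix (Fin dB) (Fin dA) ℂ)
    (hN0 : ∑ k, (N0 k)ᴴ * N0 k = 1) (hN1 : ∑ k, (N1 k)ᴴ * N1 k = 1)
    (dR : ℕ) (hdR : 0 < dR) :
    sSup {x : ℝ | ∃ (dE : ℕ), 0 < dE ∧
        ∃ P0 P1 : Matrix (Fin dR × Fin dB × Fin dE) (Fin dR × Fin dB) ℂ,
          P0ᴴ * P0 + P1ᴴ * P1 = 1 ∧ x = opNorm (chAdj N0 P0 + chAdj N1 P1)} =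
    sSup {x : ℝ |
        ∃ P0 P1 : Matrix (Fin dR × Fin dB × Fin (2 * dR * dB ^ 2)) (Fin dR × Fin dB) ℂ,
          P0ᴴ * P0 + P1ᴴ * P1 = 1 ∧ x = opNorm (chAdj N0 P0 + chAdj N1 P1)} := by
  congr 1
  ext x
  constructor
  · rintro ⟨dE, -, P0, P1, hP, rfl⟩
    obtain ⟨Q0, Q1, h0, h1, hQ⟩ := exists_opNorm_chAdj_eq (dF := 2 * dR * dB ^ 2) N0 N1
      (by nlinarith [Nat.mul_le_mul_right (dB ^ 2) hdR]) P0 P1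
    exact ⟨Q0, Q1, by rw [h0, h1, hP], hQ.symm⟩
  · rintro ⟨P0, P1, hP, rfl⟩
    rcases Nat.eq_zero_or_pos dB with rfl | hdB
    · obtain ⟨Q0, Q1, h0, h1, hQ⟩ := exists_opNorm_chAdj_eq (dF := 1) N0 N1 (by simp) P0 P1
      exact ⟨1, one_pos, Q0, Q1, by rw [h0, h1, hP], hQ.symm⟩
    · exact ⟨_, by positivity, P0, P1, hP, rfl⟩
end

section
/- Proposition 2 (saturation of the upper bound). Let N⁰ and N¹ be quantum channels from A (dimension d_A) to B (dimension d_B) with Kraus operators {N_k⁰}_{k=1}^K and {N_k¹}_{k=1}^K. Then p_coh(N⁰, N¹) = 1 if and only if the channels are orthogonal, i.e., there exist a positive integer d_R and a unit vector ψ ∈ ℂ^{d_R}⊗ℂ^{d_A} such that the matrix product [∑_{k=1}^K (I_{d_R}⊗N_k⁰) ψψ† (I_{d_R}⊗N_k⁰)†] · [∑_{k=1}^K (I_{d_R}⊗N_k¹) ψψ† (I_{d_R}⊗N_k¹)†] = 0. -/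
open scoped Kronecker Matrix

namespace CoherentDiscrimination

open Matrix

section Isometry

variable {l m n ι : Type*} [Fintype l] [DecidableEq l] [Fintype m] [DecidableEq m]
  [Fintype n] [DecidableEq n] [Fintype ι]

lemma inner_toEuclideanLin (A : Matrix m n ℂ) (B : Matrix m l ℂ)
    (x : EuclideanSpace ℂ n) (y : EuclideanSpace ℂ l) :
    inner ℂ (toEuclideanLin A x) (toEuclideanLin B y) =
      inner ℂ x (toEuclideanLin (Aᴴ * B) y) := by
  rw [toLpLin_mul_same, LinearMap.comp_apply]
  change _ = inner ℂ x (toEuclideanLin Aᴴ (toEuclideanLin B y))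
  rw [toEuclideanLin_conjTranspose_eq_adjoint, LinearMap.adjoint_inner_right]

lemma sum_inner_toEuclideanLin {W : ι → Matrix m n ℂ} (hW : ∑ k, (W k)ᴴ * W k = 1)
    (x y : EuclideanSpace ℂ n) :
    ∑ k, inner ℂ (toEuclideanLin (W k) x) (toEuclideanLin (W k) y) = inner ℂ x y := by
  simp_rw [inner_toEuclideanLin]
  rw [← inner_sum, ← LinearMap.sum_apply, ← map_sum, hW, toLpLin_one, LinearMap.id_apply]

lemma sum_norm_sq_toEuclideanLin {W : ι → Matrix m n ℂ} (hW : ∑ k, (W k)ᴴ * W k = 1)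
    (x : EuclideanSpace ℂ n) :
    ∑ k, ‖toEuclideanLin (W k) x‖ ^ 2 = ‖x‖ ^ 2 := by
  have h := sum_inner_toEuclideanLin hW x x
  simp only [inner_self_eq_norm_sq_to_K] at h
  exact_mod_cast h

lemma norm_sq_sum_toEuclideanLin_conjTranspose_le {W : ι → Matrix m n ℂ}
    (hW : ∑ k, (W k)ᴴ * W k = 1) (x : ι → EuclideanSpace ℂ m) :
    ‖∑ k, toEuclideanLin (W k)ᴴ (x k)‖ ^ 2 ≤ ∑ k, ‖x k‖ ^ 2 := by
  set y := ∑ k, toEuclideanLin (W k)ᴴ (x k) with hy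
  have key : ‖y‖ ^ 2 = ∑ k, RCLike.re (inner ℂ (toEuclideanLin (W k) y) (x k)) := by
    rw [← inner_self_eq_norm_sq (𝕜 := ℂ)]
    nth_rewrite 2 [hy]
    rw [inner_sum, map_sum]
    refine Finset.sum_congr rfl fun k _ => ?_
    rw [toEuclideanLin_conjTranspose_eq_adjoint, LinearMap.adjoint_inner_right]
  have bound : ∑ k, RCLike.re (inner ℂ (toEuclideanLin (W k) y) (x k)) ≤
      ∑ k, (‖toEuclideanLin (W k) y‖ ^ 2 + ‖x k‖ ^ 2) / 2 := by
    refine Finset.sum_le_sum fun k _ => ?_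
    have := re_inner_le_norm (𝕜 := ℂ) (toEuclideanLin (W k) y) (x k)
    nlinarith [sq_nonneg (‖toEuclideanLin (W k) y‖ - ‖x k‖)]
  rw [← Finset.sum_div, Finset.sum_add_distrib, sum_norm_sq_toEuclideanLin hW] at bound
  linarith

lemma inner_add_inner_of_isometry_pair {P Q : Matrix m n ℂ} (h : Pᴴ * P + Qᴴ * Q = 1)
    (x y : EuclideanSpace ℂ n) :
    inner ℂ (toEuclideanLin P x) (toEuclideanLin P y) +
      inner ℂ (toEuclideanLin Q x) (toEuclideanLin Q y) = inner ℂ x y := by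
  simpa using sum_inner_toEuclideanLin (W := ![P, Q]) (by simpa using h) x y

lemma norm_sq_add_norm_sq_of_isometry_pair {P Q : Matrix m n ℂ} (h : Pᴴ * P + Qᴴ * Q = 1)
    (x : EuclideanSpace ℂ n) :
    ‖toEuclideanLin P x‖ ^ 2 + ‖toEuclideanLin Q x‖ ^ 2 = ‖x‖ ^ 2 := by
  simpa using sum_norm_sq_toEuclideanLin (W := ![P, Q]) (by simpa using h) x

lemma norm_sq_inner_le_of_isometry_pair {P Q : Matrix m n ℂ} (h : Pᴴ * P + Qᴴ * Q = 1)
    {u v : EuclideanSpace ℂ n} (hu : ‖u‖ ≤ 1) (hv : ‖v‖ ≤ 1) :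
    ‖inner ℂ v u‖ ^ 2 ≤ 2 * (‖toEuclideanLin P v‖ ^ 2 + ‖toEuclideanLin Q u‖ ^ 2) := by
  have hle (x : EuclideanSpace ℂ n) (hx : ‖x‖ ≤ 1) :
      ‖toEuclideanLin P x‖ ≤ 1 ∧ ‖toEuclideanLin Q x‖ ≤ 1 := by
    have := norm_sq_add_norm_sq_of_isometry_pair h x
    constructor <;> refine abs_le_of_sq_le_sq' ?_ zero_le_one |>.2 <;>
      nlinarith [norm_nonneg x, sq_nonneg ‖toEuclideanLin P x‖, sq_nonneg ‖toEuclideanLin Q x‖]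
  have hinner : ‖inner ℂ v u‖ ≤ ‖toEuclideanLin P v‖ + ‖toEuclideanLin Q u‖ := by
    rw [← inner_add_inner_of_isometry_pair h v u]
    refine (norm_add_le _ _).trans (add_le_add ?_ ?_)
    · refine (norm_inner_le_norm _ _).trans ?_
      exact mul_le_of_le_one_right (norm_nonneg _) (hle u hu).1
    · refine (norm_inner_le_norm _ _).trans ?_
      exact mul_le_of_le_one_left (norm_nonneg _) (hle v hv).2
  refine (pow_le_pow_left₀ (norm_nonneg _) hinner 2).trans ?_
  exact add_sq_le

end Isometry

section Kronecker

variable {r m n ι : Type*} [Fintype r] [DecidableEq r] [Fintype m] [DecidableEq n] [Fintype ι]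

lemma sum_conjTranspose_mul_self_one_kronecker {N : ι → Matrix m n ℂ}
    (hN : ∑ k, (N k)ᴴ * N k = 1) :
    ∑ k, ((1 : Matrix r r ℂ) ⊗ₖ N k)ᴴ * ((1 : Matrix r r ℂ) ⊗ₖ N k) = 1 := by
  simp_rw [conjTranspose_kronecker, ← mul_kronecker_mul, conjTranspose_one, one_mul]
  have := map_sum (kroneckerBilinear (R := ℂ) (1 : Matrix r r ℂ)) (fun k => (N k)ᴴ * N k)
    Finset.univ
  rw [hN] at this
  exact this.symm.trans one_kronecker_one

lemma sum_conjTranspose_mul_self_kronecker_one {N : ι → Matrix m n ℂ}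
    (hN : ∑ k, (N k)ᴴ * N k = 1) :
    ∑ k, (N k ⊗ₖ (1 : Matrix r r ℂ))ᴴ * (N k ⊗ₖ (1 : Matrix r r ℂ)) = 1 := by
  simp_rw [conjTranspose_kronecker, ← mul_kronecker_mul, conjTranspose_one, one_mul]
  have := map_sum ((kroneckerBilinear (R := ℂ)).flip (1 : Matrix r r ℂ)) (fun k => (N k)ᴴ * N k)
    Finset.univ
  rw [hN] at this
  exact this.symm.trans one_kronecker_one

lemma inner_one_kronecker [DecidableEq m] [Fintype n] (L N : Matrix m n ℂ) (ψ : EuclideanSpace ℂ (r × n)) :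
    inner ℂ (toEuclideanLin ((1 : Matrix r r ℂ) ⊗ₖ L) ψ)
      (toEuclideanLin ((1 : Matrix r r ℂ) ⊗ₖ N) ψ) =
    ∑ a, ∑ a', (Lᴴ * N) a a' * ((of fun i a => ψ (i, a))ᴴ * of fun i a => ψ (i, a)) a a' := by
  have happly (M : Matrix n n ℂ) (i : r) (a : n) :
      toEuclideanLin ((1 : Matrix r r ℂ) ⊗ₖ M) ψ (i, a) = ∑ a', M a a' * ψ (i, a') := by
    change ∑ p : r × n, (1 : Matrix r r ℂ) i p.1 * M a p.2 * ψ p = _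
    rw [Fintype.sum_prod_type, Fintype.sum_eq_single i fun j hj => by simp [one_apply_ne' hj]]
    simp
  rw [inner_toEuclideanLin, conjTranspose_kronecker, ← mul_kronecker_mul, conjTranspose_one,
    one_mul, PiLp.inner_apply, Fintype.sum_prod_type, Finset.sum_comm]
  refine Finset.sum_congr rfl fun a _ => ?_
  simp_rw [happly, inner_sum]
  rw [Finset.sum_comm]
  refine Finset.sum_congr rfl fun a' _ => ?_
  rw [mul_apply (M := (of fun i a => ψ (i, a))ᴴ), Finset.mul_sum]
  refine Finset.sum_congr rfl fun i _ => ?_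
  change _ = (Lᴴ * N) a a' * (star (ψ (i, a)) * ψ (i, a'))
  rw [RCLike.inner_apply, starRingEnd_apply]
  ring

open scoped ComplexOrder MatrixOrder in
lemma exists_square_conjTranspose_mul_self {r : Type*} [Fintype r] [Fintype n] (M : Matrix r n ℂ) :
    ∃ S : Matrix n n ℂ, Sᴴ * S = Mᴴ * M := by
  obtain ⟨S, hS⟩ := CStarAlgebra.nonneg_iff_eq_star_mul_self.mp
    (posSemidef_conjTranspose_mul_self M).nonneg
  exact ⟨S, hS.symm⟩

lemma exists_reference_eq_input [DecidableEq m] [Fintype n] (ψ : EuclideanSpace ℂ (r × n)) :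
    ∃ φ : EuclideanSpace ℂ (n × n), ‖φ‖ = ‖ψ‖ ∧ ∀ L N : Matrix m n ℂ,
      inner ℂ (toEuclideanLin ((1 : Matrix n n ℂ) ⊗ₖ L) φ)
        (toEuclideanLin ((1 : Matrix n n ℂ) ⊗ₖ N) φ) =
      inner ℂ (toEuclideanLin ((1 : Matrix r r ℂ) ⊗ₖ L) ψ)
        (toEuclideanLin ((1 : Matrix r r ℂ) ⊗ₖ N) ψ) := by
  obtain ⟨S, hS⟩ := exists_square_conjTranspose_mul_self (of fun i a => ψ (i, a))
  have hφ : (of fun i a => (WithLp.toLp 2 fun p : n × n => S p.1 p.2 :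
      EuclideanSpace ℂ (n × n)) (i, a)) = S := rfl
  refine ⟨WithLp.toLp 2 fun p => S p.1 p.2, ?_, fun L N => ?_⟩
  · have h := inner_one_kronecker (1 : Matrix n n ℂ) 1 (WithLp.toLp 2 fun p => S p.1 p.2)
    rw [hφ, hS, ← inner_one_kronecker] at h
    simp only [one_kronecker_one, toLpLin_one, LinearMap.id_apply,
      inner_self_eq_norm_sq_to_K] at h
    exact (sq_eq_sq₀ (norm_nonneg _) (norm_nonneg _)).1 (by exact_mod_cast h)
  · rw [inner_one_kronecker, inner_one_kronecker, hφ, hS]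

end Kronecker

section Channel

variable {dA dB dR dE : ℕ} {ι : Type*} [Fintype ι]

lemma toEuclideanLin_chAdj (N : ι → Matrix (Fin dB) (Fin dA) ℂ)
    (P : Matrix (Fin dR × Fin dB × Fin dE) (Fin dR × Fin dB) ℂ)
    (ψ : EuclideanSpace ℂ (Fin dR × Fin dA)) :
    toEuclideanLin (chAdj N P) ψ =
      ∑ k, toEuclideanLin ((1 : Matrix (Fin dR) (Fin dR) ℂ) ⊗ₖ
          (N k ⊗ₖ (1 : Matrix (Fin dE) (Fin dE) ℂ)))ᴴ
        (toEuclideanLin P (toEuclideanLin ((1 : Matrix (Fin dR) (Fin dR) ℂ) ⊗ₖ N k) ψ)) := by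
  simp only [chAdj, map_sum, LinearMap.sum_apply, toLpLin_mul_same, LinearMap.comp_apply,
    conjTranspose_kronecker, conjTranspose_one]

lemma norm_sq_chAdj_le {N : ι → Matrix (Fin dB) (Fin dA) ℂ} (hN : ∑ k, (N k)ᴴ * N k = 1)
    (P : Matrix (Fin dR × Fin dB × Fin dE) (Fin dR × Fin dB) ℂ)
    (ψ : EuclideanSpace ℂ (Fin dR × Fin dA)) :
    ‖toEuclideanLin (chAdj N P) ψ‖ ^ 2 ≤
      ∑ k, ‖toEuclideanLin P (toEuclideanLin ((1 : Matrix (Fin dR) (Fin dR) ℂ) ⊗ₖ N k) ψ)‖ ^ 2 := by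
  rw [toEuclideanLin_chAdj]
  exact norm_sq_sum_toEuclideanLin_conjTranspose_le (sum_conjTranspose_mul_self_one_kronecker
    (sum_conjTranspose_mul_self_kronecker_one hN)) _

/-- The complement `Q` of `P` on the Kraus branches accounts for the norm lost by `N†(P)`. -/
lemma norm_sq_chAdj_add_le {N : ι → Matrix (Fin dB) (Fin dA) ℂ} (hN : ∑ k, (N k)ᴴ * N k = 1)
    {P Q : Matrix (Fin dR × Fin dB × Fin dE) (Fin dR × Fin dB) ℂ} (h : Pᴴ * P + Qᴴ * Q = 1)
    (ψ : EuclideanSpace ℂ (Fin dR × Fin dA)) :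
    ‖toEuclideanLin (chAdj N P) ψ‖ ^ 2 +
      ∑ k, ‖toEuclideanLin Q (toEuclideanLin ((1 : Matrix (Fin dR) (Fin dR) ℂ) ⊗ₖ N k) ψ)‖ ^ 2 ≤
      ‖ψ‖ ^ 2 := by
  have hsum := sum_norm_sq_toEuclideanLin
    (sum_conjTranspose_mul_self_one_kronecker (r := Fin dR) hN) ψ
  simp_rw [← norm_sq_add_norm_sq_of_isometry_pair h, Finset.sum_add_distrib] at hsum
  linarith [norm_sq_chAdj_le hN P ψ]

lemma norm_chAdj_le {N : ι → Matrix (Fin dB) (Fin dA) ℂ} (hN : ∑ k, (N k)ᴴ * N k = 1)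
    {P Q : Matrix (Fin dR × Fin dB × Fin dE) (Fin dR × Fin dB) ℂ} (h : Pᴴ * P + Qᴴ * Q = 1)
    (ψ : EuclideanSpace ℂ (Fin dR × Fin dA)) :
    ‖toEuclideanLin (chAdj N P) ψ‖ ≤ ‖ψ‖ := by
  refine le_of_sq_le_sq ?_ (norm_nonneg _)
  exact (le_add_of_nonneg_right (Finset.sum_nonneg fun _ _ => sq_nonneg _)).trans
    (norm_sq_chAdj_add_le hN h ψ)

lemma norm_sq_complement_le {N : ι → Matrix (Fin dB) (Fin dA) ℂ} (hN : ∑ k, (N k)ᴴ * N k = 1)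
    {P Q : Matrix (Fin dR × Fin dB × Fin dE) (Fin dR × Fin dB) ℂ} (h : Pᴴ * P + Qᴴ * Q = 1)
    {ψ : EuclideanSpace ℂ (Fin dR × Fin dA)} (hψ : ‖ψ‖ = 1) {ε : ℝ}
    (hε : 1 - ε ≤ ‖toEuclideanLin (chAdj N P) ψ‖) (k : ι) :
    ‖toEuclideanLin Q (toEuclideanLin ((1 : Matrix (Fin dR) (Fin dR) ℂ) ⊗ₖ N k) ψ)‖ ^ 2 ≤
      2 * ε := by
  have hle := norm_sq_chAdj_add_le hN h ψ
  have hQ := Finset.single_le_sum (f := fun k =>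
    ‖toEuclideanLin Q (toEuclideanLin ((1 : Matrix (Fin dR) (Fin dR) ℂ) ⊗ₖ N k) ψ)‖ ^ 2)
    (fun _ _ => sq_nonneg _) (Finset.mem_univ k)
  rw [hψ] at hle
  nlinarith [sq_nonneg (‖toEuclideanLin (chAdj N P) ψ‖ - 1)]

lemma norm_kraus_apply_le_one {N : ι → Matrix (Fin dB) (Fin dA) ℂ} (hN : ∑ k, (N k)ᴴ * N k = 1)
    {ψ : EuclideanSpace ℂ (Fin dR × Fin dA)} (hψ : ‖ψ‖ = 1) (k : ι) :
    ‖toEuclideanLin ((1 : Matrix (Fin dR) (Fin dR) ℂ) ⊗ₖ N k) ψ‖ ≤ 1 := by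
  have hsum := sum_norm_sq_toEuclideanLin
    (sum_conjTranspose_mul_self_one_kronecker (r := Fin dR) hN) ψ
  rw [hψ] at hsum
  refine le_of_sq_le_sq ?_ zero_le_one
  rw [← hsum]
  exact Finset.single_le_sum (f := fun k =>
    ‖toEuclideanLin ((1 : Matrix (Fin dR) (Fin dR) ℂ) ⊗ₖ N k) ψ‖ ^ 2)
    (fun _ _ => sq_nonneg _) (Finset.mem_univ k)

/-- The total overlap of the Kraus branches of two channels on the input `ψ`. -/
noncomputable def krausOverlap (N0 N1 : ι → Matrix (Fin dB) (Fin dA) ℂ)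
    (ψ : EuclideanSpace ℂ (Fin dR × Fin dA)) : ℝ :=
  ∑ j, ∑ k, ‖inner ℂ (toEuclideanLin ((1 : Matrix (Fin dR) (Fin dR) ℂ) ⊗ₖ N1 j) ψ)
    (toEuclideanLin ((1 : Matrix (Fin dR) (Fin dR) ℂ) ⊗ₖ N0 k) ψ)‖ ^ 2

variable {N0 N1 : ι → Matrix (Fin dB) (Fin dA) ℂ}

lemma krausOverlap_nonneg (ψ : EuclideanSpace ℂ (Fin dR × Fin dA)) :
    0 ≤ krausOverlap N0 N1 ψ :=
  Finset.sum_nonneg fun _ _ => Finset.sum_nonneg fun _ _ => sq_nonneg _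

lemma continuous_krausOverlap :
    Continuous fun ψ : EuclideanSpace ℂ (Fin dR × Fin dA) => krausOverlap N0 N1 ψ := by
  have hcont (N : Matrix (Fin dB) (Fin dA) ℂ) :
      Continuous (toEuclideanLin ((1 : Matrix (Fin dR) (Fin dR) ℂ) ⊗ₖ N)) :=
    LinearMap.continuous_of_finiteDimensional _
  unfold krausOverlap
  fun_prop

lemma krausOverlap_eq_zero_iff {ψ : EuclideanSpace ℂ (Fin dR × Fin dA)} :
    krausOverlap N0 N1 ψ = 0 ↔
      ∀ j k, inner ℂ (toEuclideanLin ((1 : Matrix (Fin dR) (Fin dR) ℂ) ⊗ₖ N1 j) ψ)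
        (toEuclideanLin ((1 : Matrix (Fin dR) (Fin dR) ℂ) ⊗ₖ N0 k) ψ) = 0 := by
  rw [krausOverlap, Finset.sum_eq_zero_iff_of_nonneg
    fun _ _ => Finset.sum_nonneg fun _ _ => sq_nonneg _]
  simp [Finset.sum_eq_zero_iff_of_nonneg]

lemma krausOverlap_le (hN0 : ∑ k, (N0 k)ᴴ * N0 k = 1) (hN1 : ∑ k, (N1 k)ᴴ * N1 k = 1)
    {P0 P1 : Matrix (Fin dR × Fin dB × Fin dE) (Fin dR × Fin dB) ℂ}
    (h : P0ᴴ * P0 + P1ᴴ * P1 = 1) {ψ : EuclideanSpace ℂ (Fin dR × Fin dA)} (hψ : ‖ψ‖ = 1) {ε : ℝ}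
    (hε : 2 - ε ≤ ‖toEuclideanLin (chAdj N0 P0 + chAdj N1 P1) ψ‖) :
    krausOverlap N0 N1 ψ ≤ (Fintype.card ι : ℝ) ^ 2 * (8 * ε) := by
  have h' : P1ᴴ * P1 + P0ᴴ * P0 = 1 := by rwa [add_comm]
  rw [map_add, LinearMap.add_apply] at hε
  have htri := norm_add_le (toEuclideanLin (chAdj N0 P0) ψ) (toEuclideanLin (chAdj N1 P1) ψ)
  have h0 := norm_chAdj_le hN0 h ψ
  have h1 := norm_chAdj_le hN1 h' ψ
  rw [hψ] at h0 h1
  have hle (j k : ι) : ‖inner ℂ (toEuclideanLin ((1 : Matrix (Fin dR) (Fin dR) ℂ) ⊗ₖ N1 j) ψ)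
      (toEuclideanLin ((1 : Matrix (Fin dR) (Fin dR) ℂ) ⊗ₖ N0 k) ψ)‖ ^ 2 ≤ 8 * ε := by
    have := norm_sq_inner_le_of_isometry_pair h (norm_kraus_apply_le_one hN0 hψ k)
      (norm_kraus_apply_le_one hN1 hψ j)
    have hQ := norm_sq_complement_le hN0 h hψ (ε := ε) (by linarith) k
    have hP := norm_sq_complement_le hN1 h' hψ (ε := ε) (by linarith) j
    linarith
  refine (Finset.sum_le_sum fun j _ => Finset.sum_le_sum fun k _ => hle j k).trans_eq ?_
  simp only [Finset.sum_const, Finset.card_univ, nsmul_eq_mul]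
  ring

lemma opNorm_chAdj_add_le (hN0 : ∑ k, (N0 k)ᴴ * N0 k = 1) (hN1 : ∑ k, (N1 k)ᴴ * N1 k = 1)
    {P0 P1 : Matrix (Fin dR × Fin dB × Fin dE) (Fin dR × Fin dB) ℂ}
    (h : P0ᴴ * P0 + P1ᴴ * P1 = 1) : opNorm (chAdj N0 P0 + chAdj N1 P1) ≤ 2 := by
  refine ContinuousLinearMap.opNorm_le_bound _ zero_le_two fun ψ => ?_
  rw [LinearMap.coe_toContinuousLinearMap', map_add, LinearMap.add_apply]
  have h0 := norm_chAdj_le hN0 h ψ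
  have h1 := norm_chAdj_le hN1 (by rwa [add_comm]) ψ
  linarith [norm_add_le (toEuclideanLin (chAdj N0 P0) ψ) (toEuclideanLin (chAdj N1 P1) ψ)]

/-- The reference system may be taken to be as large as the input system, so by compactness
near-perfect discrimination with arbitrary accuracy gives an input with orthogonal branches. -/
lemma exists_krausOverlap_eq_zero (hN0 : ∑ k, (N0 k)ᴴ * N0 k = 1)
    (hN1 : ∑ k, (N1 k)ᴴ * N1 k = 1)
    (h : ∀ ε : ℝ, 0 < ε → ∃ (dR dE : ℕ),
      ∃ P0 P1 : Matrix (Fin dR × Fin dB × Fin dE) (Fin dR × Fin dB) ℂ,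
        P0ᴴ * P0 + P1ᴴ * P1 = 1 ∧ 2 - ε < opNorm (chAdj N0 P0 + chAdj N1 P1)) :
    ∃ φ : EuclideanSpace ℂ (Fin dA × Fin dA), ‖φ‖ = 1 ∧ krausOverlap N0 N1 φ = 0 := by
  have approx (ε : ℝ) (hε : 0 < ε) (hε2 : ε ≤ 2) :
      ∃ φ : EuclideanSpace ℂ (Fin dA × Fin dA), ‖φ‖ = 1 ∧
        krausOverlap N0 N1 φ ≤ (Fintype.card ι : ℝ) ^ 2 * (8 * ε) := by
    obtain ⟨dR, dE, P0, P1, hP, hlt⟩ := h ε hε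
    obtain ⟨ψ, hψ, hlt⟩ : ∃ ψ : EuclideanSpace ℂ (Fin dR × Fin dA), ‖ψ‖ = 1 ∧
        2 - ε < ‖toEuclideanLin (chAdj N0 P0 + chAdj N1 P1) ψ‖ := by
      by_contra! hcon
      exact hlt.not_ge (ContinuousLinearMap.opNorm_le_of_unit_norm (by linarith) hcon)
    obtain ⟨φ, hφ, heq⟩ := exists_reference_eq_input (m := Fin dB) ψ
    refine ⟨φ, hφ.trans hψ, ?_⟩
    have := krausOverlap_le hN0 hN1 hP hψ hlt.le
    simpa only [krausOverlap, heq] using this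
  have hne : (Metric.sphere (0 : EuclideanSpace ℂ (Fin dA × Fin dA)) 1).Nonempty := by
    obtain ⟨φ, hφ, -⟩ := approx 1 one_pos one_le_two
    exact ⟨φ, by simpa using hφ⟩
  obtain ⟨φ, hφ, hmin⟩ := (isCompact_sphere _ _).exists_isMinOn hne
    (continuous_krausOverlap (N0 := N0) (N1 := N1)).continuousOn
  refine ⟨φ, by simpa using hφ, le_antisymm ?_ (krausOverlap_nonneg φ)⟩
  refine le_of_forall_pos_le_add fun δ hδ => ?_
  have hpos : (0 : ℝ) < 8 * (Fintype.card ι : ℝ) ^ 2 + δ := by positivity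
  obtain ⟨φ', hφ', hle⟩ := approx (δ / (8 * (Fintype.card ι : ℝ) ^ 2 + δ)) (by positivity)
    (((div_le_one hpos).2 (by nlinarith [sq_nonneg (Fintype.card ι : ℝ)])).trans one_le_two)
  have hmem : φ' ∈ Metric.sphere (0 : EuclideanSpace ℂ (Fin dA × Fin dA)) 1 := by simpa using hφ'
  refine (hmin hmem).trans (hle.trans ?_)
  rw [zero_add, ← mul_assoc, mul_div_assoc', div_le_iff₀ hpos]
  nlinarith

/-- Forgetting a one-dimensional environment. -/
def dropEnvironment {r b : Type*} (p : r × b × Fin 1) : r × b := (p.1, p.2.1)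

lemma dropEnvironment_bijective {r b : Type*} :
    Function.Bijective (dropEnvironment (r := r) (b := b)) := by
  refine ⟨fun p q hpq => ?_, fun p => ⟨(p.1, p.2, 0), rfl⟩⟩
  obtain ⟨h1, h2⟩ := Prod.mk.inj hpq
  exact Prod.ext h1 (Prod.ext h2 (Subsingleton.elim _ _))

lemma toEuclideanLin_submatrix_dropEnvironment (M : Matrix (Fin dR × Fin dB) (Fin dR × Fin dA) ℂ)
    (x : EuclideanSpace ℂ (Fin dR × Fin dA)) :
    toEuclideanLin (M.submatrix (dropEnvironment (r := Fin dR) (b := Fin dB)) id) x =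
      WithLp.toLp 2 fun p => toEuclideanLin M x (dropEnvironment p) := rfl

lemma norm_dropEnvironment (x : EuclideanSpace ℂ (Fin dR × Fin dB)) :
    ‖(WithLp.toLp 2 fun p => x (dropEnvironment p) :
      EuclideanSpace ℂ (Fin dR × Fin dB × Fin 1))‖ = ‖x‖ := by
  simp_rw [EuclideanSpace.norm_eq]
  rw [dropEnvironment_bijective.sum_comp fun p => ‖x p‖ ^ 2]

lemma conjTranspose_mul_submatrix_dropEnvironment
    (M : Matrix (Fin dR × Fin dB) (Fin dR × Fin dA) ℂ) :
    (M.submatrix (dropEnvironment (r := Fin dR) (b := Fin dB)) id)ᴴ *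
      M.submatrix dropEnvironment id = Mᴴ * M := by
  ext a a'
  simp only [mul_apply, conjTranspose_apply, submatrix_apply, id]
  exact dropEnvironment_bijective.sum_comp fun p => star (M p a) * M p a'

lemma chAdj_submatrix_dropEnvironment (N : ι → Matrix (Fin dB) (Fin dA) ℂ)
    (P : Matrix (Fin dR × Fin dB) (Fin dR × Fin dB) ℂ) :
    chAdj N (P.submatrix dropEnvironment id) =
      (∑ k, ((1 : Matrix (Fin dR) (Fin dR) ℂ) ⊗ₖ N k)ᴴ * P *
        ((1 : Matrix (Fin dR) (Fin dR) ℂ) ⊗ₖ N k)).submatrix dropEnvironment id := by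
  have hleft (k : ι) : ((1 : Matrix (Fin dR) (Fin dR) ℂ) ⊗ₖ
      ((N k)ᴴ ⊗ₖ (1 : Matrix (Fin 1) (Fin 1) ℂ))) * P.submatrix dropEnvironment id =
      (((1 : Matrix (Fin dR) (Fin dR) ℂ) ⊗ₖ N k)ᴴ * P).submatrix dropEnvironment id := by
    ext p q
    rw [conjTranspose_kronecker, conjTranspose_one]
    simp only [mul_apply, submatrix_apply, id]
    rw [← dropEnvironment_bijective.sum_comp fun s =>
      ((1 : Matrix (Fin dR) (Fin dR) ℂ) ⊗ₖ (N k)ᴴ) (dropEnvironment p) s * P s q]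
    refine Finset.sum_congr rfl fun s _ => ?_
    simp [dropEnvironment, one_apply, Subsingleton.elim p.2.2 s.2.2]
  ext p q
  simp only [chAdj, hleft, submatrix_apply, Matrix.sum_apply]
  rfl

lemma exists_complementary_projections {ι b : Type*} [Fintype b] [DecidableEq b]
    (u v : ι → EuclideanSpace ℂ b) (huv : ∀ j k, inner ℂ (v j) (u k) = 0) :
    ∃ P Q : Matrix b b ℂ, Pᴴ * P + Qᴴ * Q = 1 ∧ (∀ k, toEuclideanLin P (u k) = u k) ∧
      ∀ k, toEuclideanLin Q (v k) = v k := by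
  let S := Submodule.span ℂ (Set.range u)
  let P : Matrix b b ℂ := toEuclideanLin.symm S.starProjection.toLinearMap
  have hP (x : EuclideanSpace ℂ b) : toEuclideanLin P x = S.starProjection x := by
    simp [P]
  have hself : Pᴴ = P := by
    apply toEuclideanLin.injective
    rw [toEuclideanLin_conjTranspose_eq_adjoint, eq_comm, LinearMap.eq_adjoint_iff]
    intro x y
    rw [hP, hP, Submodule.inner_starProjection_left_eq_right]
  have hidem : P * P = P := by
    apply toEuclideanLin.injective
    ext1 x
    rw [toLpLin_mul_same, LinearMap.comp_apply, hP, hP]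
    exact Submodule.starProjection_eq_self_iff.2 (Submodule.starProjection_apply_mem _ _)
  refine ⟨P, 1 - P, ?_, fun k => ?_, fun k => ?_⟩
  · rw [conjTranspose_sub, conjTranspose_one, hself, sub_mul, mul_sub, mul_sub, hidem]
    simp
  · rw [hP]
    exact Submodule.starProjection_eq_self_iff.2 (Submodule.subset_span ⟨k, rfl⟩)
  · rw [map_sub, LinearMap.sub_apply, hP, toLpLin_one, LinearMap.id_apply, sub_eq_self,
      Submodule.starProjection_apply_eq_zero_iff, Submodule.mem_orthogonal]
    intro w hw
    induction hw using Submodule.span_induction with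
    | mem w hw =>
      obtain ⟨j, rfl⟩ := hw
      exact inner_eq_zero_symm.1 (huv k j)
    | zero => exact inner_zero_left _
    | add x y _ _ hx hy => rw [inner_add_left, hx, hy, add_zero]
    | smul c x _ hx => rw [inner_smul_left, hx, mul_zero]

lemma toEuclideanLin_sum_conj_eq_self {N : ι → Matrix (Fin dB) (Fin dA) ℂ}
    (hN : ∑ k, (N k)ᴴ * N k = 1) {P : Matrix (Fin dR × Fin dB) (Fin dR × Fin dB) ℂ}
    {ψ : EuclideanSpace ℂ (Fin dR × Fin dA)}
    (hP : ∀ k, toEuclideanLin P (toEuclideanLin ((1 : Matrix (Fin dR) (Fin dR) ℂ) ⊗ₖ N k) ψ) =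
      toEuclideanLin ((1 : Matrix (Fin dR) (Fin dR) ℂ) ⊗ₖ N k) ψ) :
    toEuclideanLin (∑ k, ((1 : Matrix (Fin dR) (Fin dR) ℂ) ⊗ₖ N k)ᴴ * P *
      ((1 : Matrix (Fin dR) (Fin dR) ℂ) ⊗ₖ N k)) ψ = ψ := by
  have hterm (k : ι) : toEuclideanLin (((1 : Matrix (Fin dR) (Fin dR) ℂ) ⊗ₖ N k)ᴴ * P *
      ((1 : Matrix (Fin dR) (Fin dR) ℂ) ⊗ₖ N k)) ψ =
      toEuclideanLin (((1 : Matrix (Fin dR) (Fin dR) ℂ) ⊗ₖ N k)ᴴ *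
        ((1 : Matrix (Fin dR) (Fin dR) ℂ) ⊗ₖ N k)) ψ := by
    simp only [toLpLin_mul_same, LinearMap.comp_apply, hP]
  simp_rw [map_sum, LinearMap.sum_apply, hterm]
  rw [← LinearMap.sum_apply, ← map_sum, sum_conjTranspose_mul_self_one_kronecker hN, toLpLin_one,
    LinearMap.id_apply]

lemma exists_two_le_opNorm (hN0 : ∑ k, (N0 k)ᴴ * N0 k = 1) (hN1 : ∑ k, (N1 k)ᴴ * N1 k = 1)
    {ψ : EuclideanSpace ℂ (Fin dR × Fin dA)} (hψ : ‖ψ‖ = 1) (h : krausOverlap N0 N1 ψ = 0) :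
    ∃ P0 P1 : Matrix (Fin dR × Fin dB × Fin 1) (Fin dR × Fin dB) ℂ,
      P0ᴴ * P0 + P1ᴴ * P1 = 1 ∧ 2 ≤ opNorm (chAdj N0 P0 + chAdj N1 P1) := by
  obtain ⟨P, Q, hPQ, hP, hQ⟩ :=
    exists_complementary_projections _ _ (krausOverlap_eq_zero_iff.1 h)
  refine ⟨P.submatrix dropEnvironment id, Q.submatrix dropEnvironment id, ?_, ?_⟩
  · rw [conjTranspose_mul_submatrix_dropEnvironment, conjTranspose_mul_submatrix_dropEnvironment,
      hPQ]
  · refine le_trans ?_ (ContinuousLinearMap.unit_le_opNorm _ ψ hψ.le)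
    rw [LinearMap.coe_toContinuousLinearMap', map_add, LinearMap.add_apply,
      chAdj_submatrix_dropEnvironment, chAdj_submatrix_dropEnvironment,
      toEuclideanLin_submatrix_dropEnvironment, toEuclideanLin_submatrix_dropEnvironment,
      toEuclideanLin_sum_conj_eq_self hN0 hP, toEuclideanLin_sum_conj_eq_self hN1 hQ,
      ← two_smul ℝ, norm_smul, norm_dropEnvironment, hψ]
    norm_num

lemma pcoh_eq_one_iff_krausOverlap (hN0 : ∑ k, (N0 k)ᴴ * N0 k = 1)
    (hN1 : ∑ k, (N1 k)ᴴ * N1 k = 1) :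
    pcoh N0 N1 = 1 ↔ ∃ (dR : ℕ), 0 < dR ∧
      ∃ ψ : EuclideanSpace ℂ (Fin dR × Fin dA), ‖ψ‖ = 1 ∧ krausOverlap N0 N1 ψ = 0 := by
  have hpos : ∀ x ∈ {x : ℝ | ∃ (dR dE : ℕ), 0 < dR ∧ 0 < dE ∧
      ∃ P0 P1 : Matrix (Fin dR × Fin dB × Fin dE) (Fin dR × Fin dB) ℂ,
        P0ᴴ * P0 + P1ᴴ * P1 = 1 ∧ x = opNorm (chAdj N0 P0 + chAdj N1 P1)}, 0 ≤ x ∧ x ≤ 2 := by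
    rintro x ⟨dR, dE, -, -, P0, P1, hP, rfl⟩
    exact ⟨norm_nonneg _, opNorm_chAdj_add_le hN0 hN1 hP⟩
  rw [pcoh]
  set S := {x : ℝ | ∃ (dR dE : ℕ), 0 < dR ∧ 0 < dE ∧
      ∃ P0 P1 : Matrix (Fin dR × Fin dB × Fin dE) (Fin dR × Fin dB) ℂ,
        P0ᴴ * P0 + P1ᴴ * P1 = 1 ∧ x = opNorm (chAdj N0 P0 + chAdj N1 P1)}
  have hnonneg : 0 ≤ sSup S := Real.sSup_nonneg fun x hx => (hpos x hx).1
  constructor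
  · intro h
    have hsup : sSup S = 2 := by
      rcases sq_eq_one_iff.1 h with h | h <;> linarith
    have hne : S.Nonempty := by
      by_contra hemp
      rw [Set.not_nonempty_iff_eq_empty.1 hemp, Real.sSup_empty] at hsup
      norm_num at hsup
    obtain ⟨φ, hφ, hzero⟩ := exists_krausOverlap_eq_zero hN0 hN1 fun ε hε => by
      obtain ⟨x, ⟨dR, dE, -, -, P0, P1, hP, rfl⟩, hlt⟩ :=
        exists_lt_of_lt_csSup hne (show 2 - ε < sSup S by linarith)
      exact ⟨dR, dE, P0, P1, hP, hlt⟩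
    refine ⟨dA, Nat.pos_of_ne_zero ?_, φ, hφ, hzero⟩
    rintro rfl
    rw [Subsingleton.elim φ 0, norm_zero] at hφ
    exact zero_ne_one hφ
  · rintro ⟨dR, hdR, ψ, hψ, hzero⟩
    obtain ⟨P0, P1, hP, hle⟩ := exists_two_le_opNorm hN0 hN1 hψ hzero
    have hmem : opNorm (chAdj N0 P0 + chAdj N1 P1) ∈ S :=
      ⟨dR, 1, hdR, one_pos, P0, P1, hP, rfl⟩
    have hsup : sSup S = 2 := le_antisymm (csSup_le ⟨_, hmem⟩ fun x hx => (hpos x hx).2)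
      (hle.trans (le_csSup ⟨2, fun x hx => (hpos x hx).2⟩ hmem))
    rw [hsup]
    norm_num

lemma channel_output_eq (N : ι → Matrix (Fin dB) (Fin dA) ℂ) (ψ : Fin dR × Fin dA → ℂ) :
    ∑ k, ((1 : Matrix (Fin dR) (Fin dR) ℂ) ⊗ₖ N k) * vecMulVec ψ (star ψ) *
        ((1 : Matrix (Fin dR) (Fin dR) ℂ) ⊗ₖ N k)ᴴ =
      ∑ k, vecMulVec (((1 : Matrix (Fin dR) (Fin dR) ℂ) ⊗ₖ N k) *ᵥ ψ)
        (star (((1 : Matrix (Fin dR) (Fin dR) ℂ) ⊗ₖ N k) *ᵥ ψ)) := by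
  simp_rw [mul_vecMulVec, vecMulVec_mul, star_mulVec]

lemma sum_vecMulVec_mul_sum_vecMulVec_eq_zero_iff {b : Type*} [Fintype b] (u v : ι → b → ℂ) :
    (∑ k, vecMulVec (u k) (star (u k))) * (∑ j, vecMulVec (v j) (star (v j))) = 0 ↔
      ∀ j k, star (v j) ⬝ᵥ u k = 0 := by
  have hstar (j k : ι) : star (u k) ⬝ᵥ v j = star (star (v j) ⬝ᵥ u k) := by
    rw [star_dotProduct]
  constructor
  · intro h
    have htr := congrArg trace h
    have hterm (k j : ι) : trace (vecMulVec (u k) (star (u k)) * vecMulVec (v j) (star (v j))) =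
        ((‖star (v j) ⬝ᵥ u k‖ ^ 2 : ℝ) : ℂ) := by
      rw [vecMulVec_mul_vecMulVec, trace_vecMulVec, dotProduct_smul, hstar,
        dotProduct_comm (u k), smul_eq_mul]
      push_cast
      exact Complex.conj_mul' _
    simp_rw [Finset.sum_mul, Finset.mul_sum, trace_sum, hterm, trace_zero] at htr
    norm_cast at htr
    intro j k
    rw [Finset.sum_eq_zero_iff_of_nonneg
      fun _ _ => Finset.sum_nonneg fun _ _ => sq_nonneg _] at htr
    have := (Finset.sum_eq_zero_iff_of_nonneg fun _ _ => sq_nonneg _).1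
      (htr k (Finset.mem_univ k)) j (Finset.mem_univ j)
    simpa using this
  · intro h
    simp_rw [Finset.sum_mul, Finset.mul_sum, vecMulVec_mul_vecMulVec, hstar, h, star_zero,
      zero_smul, vecMulVec_zero, Finset.sum_const_zero]

end Channel
end CoherentDiscrimination

/-- Proposition 2 (saturation of the upper bound): `p_coh(N⁰,N¹) = 1` if and only if the
channels are orthogonal, i.e., there exist a positive integer `d_R` and a unit vector
`ψ ∈ ℂ^{d_R}⊗ℂ^{d_A}` such that
`[∑ₖ (I⊗N⁰ₖ) ψψ† (I⊗N⁰ₖ)ᴴ] · [∑ₖ (I⊗N¹ₖ) ψψ† (I⊗N¹ₖ)ᴴ] = 0`. -/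
theorem pcoh_eq_one_iff_orthogonal {dA dB K : ℕ}
    (N0 N1 : Fin K → Matrix (Fin dB) (Fin dA) ℂ)
    (hN0 : ∑ k, (N0 k)ᴴ * N0 k = 1) (hN1 : ∑ k, (N1 k)ᴴ * N1 k = 1) :
    pcoh N0 N1 = 1 ↔
      ∃ (dR : ℕ), 0 < dR ∧ ∃ ψ : Fin dR × Fin dA → ℂ, (∑ p, ‖ψ p‖^2 = 1) ∧
        (∑ k, ((1 : Matrix (Fin dR) (Fin dR) ℂ) ⊗ₖ N0 k) * Matrix.vecMulVec ψ (star ψ) *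
            ((1 : Matrix (Fin dR) (Fin dR) ℂ) ⊗ₖ N0 k)ᴴ) *
        (∑ k, ((1 : Matrix (Fin dR) (Fin dR) ℂ) ⊗ₖ N1 k) * Matrix.vecMulVec ψ (star ψ) *
            ((1 : Matrix (Fin dR) (Fin dR) ℂ) ⊗ₖ N1 k)ᴴ) = 0 := by
  rw [CoherentDiscrimination.pcoh_eq_one_iff_krausOverlap hN0 hN1]
  refine exists_congr fun dR => and_congr_right fun _ => ?_
  refine (WithLp.equiv 2 (Fin dR × Fin dA → ℂ)).exists_congr fun ψ => and_congr ?_ ?_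
  · rw [← pow_left_inj₀ (norm_nonneg _) zero_le_one two_ne_zero, one_pow,
      EuclideanSpace.norm_sq_eq]
    rfl
  · rw [CoherentDiscrimination.channel_output_eq, CoherentDiscrimination.channel_output_eq,
      CoherentDiscrimination.sum_vecMulVec_mul_sum_vecMulVec_eq_zero_iff,
      CoherentDiscrimination.krausOverlap_eq_zero_iff]
    refine forall₂_congr fun j k => ?_
    rw [EuclideanSpace.inner_eq_star_dotProduct, dotProduct_comm]
    rfl
end

section
/- Theorem 1 (non-increase of the coherent-discrimination success probability under a quantum superchannel). Let N⁰ and N¹ be quantum channels from A (dimension d_A) to B (dimension d_B) with Kraus operators {N_k⁰}_{k=1}^K and {N_k¹}_{k=1}^K. Let a superchannel from (A→B) channels to (C→D) channels be realized by a pre-processing channel E from C (dimension d_C) to A⊗M (dimension d_A d_M) with Kraus operators {E_m}_{m=1}^{K_E} (complex (d_A d_M)×d_C matrices with ∑_m E_m†E_m = I_{d_C}) and a post-processing channel D from B⊗M (dimension d_B d_M) to D (dimension d_D) with Kraus operators {D_n}_{n=1}^{K_D} (complex d_D×(d_B d_M) matrices with ∑_n D_n†D_n = I_{d_B d_M}).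 For i ∈ {0,1}, the output channel Θ(N^i) is the quantum channel from C to D with Kraus operators {D_n (N_k^i ⊗ I_{d_M}) E_m}_{k,m,n}. Then p_coh(Θ(N⁰), Θ(N¹)) ≤ p_coh(N⁰, N¹). -/
open scoped Kronecker Matrix

open scoped Matrix.Norms.L2Operator MatrixOrder ComplexOrder

section OperatorNorm

variable {ι l m n p : Type*} [Fintype ι] [Fintype l] [Fintype m] [Fintype n] [Fintype p]
  [DecidableEq l] [DecidableEq m] [DecidableEq n] [DecidableEq p]

theorem inner_toEuclideanLin_conjTranspose (A : Matrix m n ℂ) (y : EuclideanSpace ℂ n)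
    (x : EuclideanSpace ℂ m) :
    inner ℂ y (Matrix.toEuclideanLin Aᴴ x) = inner ℂ (Matrix.toEuclideanLin A y) x := by
  rw [Matrix.toEuclideanLin_conjTranspose_eq_adjoint, LinearMap.adjoint_inner_right]

theorem sum_norm_sq_toEuclideanLin (R : ι → Matrix m n ℂ) (hR : ∑ k, (R k)ᴴ * R k = 1)
    (x : EuclideanSpace ℂ n) : ∑ k, ‖Matrix.toEuclideanLin (R k) x‖ ^ 2 = ‖x‖ ^ 2 := by
  have h : ∀ k, ‖Matrix.toEuclideanLin (R k) x‖ ^ 2 =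
      RCLike.re (inner ℂ x (Matrix.toEuclideanLin ((R k)ᴴ * R k) x)) := by
    intro k
    rw [Matrix.toLpLin_mul (q := 2), LinearMap.comp_apply, inner_toEuclideanLin_conjTranspose,
      inner_self_eq_norm_sq]
  rw [Finset.sum_congr rfl fun k _ => h k, ← map_sum, ← inner_sum, ← LinearMap.sum_apply,
    ← map_sum, hR, Matrix.toLpLin_one, LinearMap.id_apply, inner_self_eq_norm_sq]

omit [DecidableEq m] in
theorem norm_toEuclideanLin_le (A : Matrix m n ℂ) (x : EuclideanSpace ℂ n) :
    ‖Matrix.toEuclideanLin A x‖ ≤ ‖A‖ * ‖x‖ :=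
  Matrix.l2_opNorm_mulVec A x

/-- Compression by two isometric families of Kraus operators does not increase the norm. -/
theorem norm_sum_conjTranspose_mul_mul_le (L : ι → Matrix p l ℂ) (R : ι → Matrix m n ℂ)
    (P : Matrix p m ℂ) (hL : ∑ k, (L k)ᴴ * L k = 1) (hR : ∑ k, (R k)ᴴ * R k = 1) :
    ‖∑ k, (L k)ᴴ * P * R k‖ ≤ ‖P‖ := by
  refine ContinuousLinearMap.opNorm_le_bound _ (norm_nonneg _) fun x => ?_
  set S := ∑ k, (L k)ᴴ * P * R k with hS
  change ‖Matrix.toEuclideanLin S x‖ ≤ _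
  set y := Matrix.toEuclideanLin S x with hy
  have key : ‖y‖ ^ 2 ≤ ‖P‖ * (‖y‖ * ‖x‖) := by
    have h1 : inner ℂ y y = ∑ k, inner ℂ (Matrix.toEuclideanLin (L k) y)
        (Matrix.toEuclideanLin P (Matrix.toEuclideanLin (R k) x)) := by
      nth_rewrite 2 [hy]
      rw [hS, map_sum, LinearMap.sum_apply, inner_sum]
      refine Finset.sum_congr rfl fun k _ => ?_
      rw [Matrix.toLpLin_mul (q := 2), Matrix.toLpLin_mul (q := 2), LinearMap.comp_apply,
        LinearMap.comp_apply, inner_toEuclideanLin_conjTranspose]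
    calc ‖y‖ ^ 2 = ‖(inner ℂ y y : ℂ)‖ := by simp [inner_self_eq_norm_sq_to_K]
      _ ≤ ∑ k, ‖Matrix.toEuclideanLin (L k) y‖ *
            (‖P‖ * ‖Matrix.toEuclideanLin (R k) x‖) := by
          rw [h1]
          refine (norm_sum_le _ _).trans (Finset.sum_le_sum fun k _ => ?_)
          exact (norm_inner_le_norm _ _).trans
            (mul_le_mul_of_nonneg_left (norm_toEuclideanLin_le _ _) (norm_nonneg _))
      _ = ‖P‖ * ∑ k, ‖Matrix.toEuclideanLin (L k) y‖ * ‖Matrix.toEuclideanLin (R k) x‖ := by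
          rw [Finset.mul_sum]
          exact Finset.sum_congr rfl fun k _ => by ring
      _ ≤ ‖P‖ * (‖y‖ * ‖x‖) := by
          refine mul_le_mul_of_nonneg_left ?_ (norm_nonneg _)
          refine abs_le_of_sq_le_sq' ?_ (by positivity) |>.2
          rw [mul_pow, ← sum_norm_sq_toEuclideanLin L hL y, ← sum_norm_sq_toEuclideanLin R hR x]
          exact Finset.sum_mul_sq_le_sq_mul_sq _ _ _
  rcases (norm_nonneg y).eq_or_lt with h0 | h0
  · rw [← h0]; positivity
  · nlinarith

theorem norm_one_submatrix_le (e : n → m) (he : Function.Injective e) :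
    ‖((1 : Matrix m m ℂ).submatrix id e)‖ ≤ 1 := by
  have h : ((1 : Matrix m m ℂ).submatrix id e)ᴴ * (1 : Matrix m m ℂ).submatrix id e = 1 := by
    rw [Matrix.conjTranspose_submatrix, Matrix.conjTranspose_one,
      ← Matrix.submatrix_mul _ _ e id e Function.bijective_id, mul_one, Matrix.submatrix_one _ he]
  have h2 := Matrix.l2_opNorm_conjTranspose_mul_self ((1 : Matrix m m ℂ).submatrix id e)
  rw [h, ← Matrix.diagonal_one, Matrix.l2_opNorm_diagonal] at h2
  have h3 : ‖(1 : n → ℂ)‖ ≤ 1 := (pi_norm_le_iff_of_nonneg zero_le_one).2 (by simp)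
  change ‖(1 : n → ℂ)‖ = _ at h2
  nlinarith [norm_nonneg ((1 : Matrix m m ℂ).submatrix id e)]

theorem norm_submatrix_le (A : Matrix m n ℂ) (e : l → m) (f : p → n)
    (he : Function.Injective e) (hf : Function.Injective f) : ‖A.submatrix e f‖ ≤ ‖A‖ := by
  have h : A.submatrix e f =
      ((1 : Matrix m m ℂ).submatrix id e)ᴴ * A * (1 : Matrix n n ℂ).submatrix id f := by
    ext i j
    simp [Matrix.mul_apply, Matrix.one_apply]
  rw [h]
  calc _ ≤ ‖((1 : Matrix m m ℂ).submatrix id e)ᴴ‖ * ‖A‖ *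
        ‖(1 : Matrix n n ℂ).submatrix id f‖ :=
        (Matrix.l2_opNorm_mul _ _).trans
          (mul_le_mul_of_nonneg_right (Matrix.l2_opNorm_mul _ _) (norm_nonneg _))
    _ ≤ 1 * ‖A‖ * 1 := by
        rw [Matrix.l2_opNorm_conjTranspose]
        gcongr
        · exact norm_one_submatrix_le e he
        · exact norm_one_submatrix_le f hf
    _ = ‖A‖ := by ring

theorem norm_submatrix_equiv (A : Matrix m n ℂ) (e : l ≃ m) (f : p ≃ n) :
    ‖A.submatrix e f‖ = ‖A‖ := by
  refine le_antisymm (norm_submatrix_le A e f e.injective f.injective) ?_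
  have := norm_submatrix_le (A.submatrix e f) e.symm f.symm e.symm.injective f.symm.injective
  simpa using this

omit [DecidableEq m] in
theorem conjTranspose_mul_self_le_one_iff (A : Matrix m n ℂ) : Aᴴ * A ≤ 1 ↔ ‖A‖ ≤ 1 := by
  have h0 : 0 ≤ Aᴴ * A := (Matrix.posSemidef_conjTranspose_mul_self A).nonneg
  rw [← CStarAlgebra.norm_le_one_iff_of_nonneg _ h0, Matrix.l2_opNorm_conjTranspose_mul_self]
  constructor <;> intro h <;> nlinarith [norm_nonneg A]

end OperatorNorm

section KrausAdjoint

variable {ι κ r a b c e e' m : Type*} [Fintype ι] [Fintype κ] [Fintype r] [Fintype a] [Fintype b]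
  [Fintype c] [Fintype e] [Fintype e'] [Fintype m] [DecidableEq r] [DecidableEq a] [DecidableEq b]
  [DecidableEq c] [DecidableEq e] [DecidableEq e'] [DecidableEq m]

/-- The extended adjoint of a Kraus family over arbitrary finite index types. -/
noncomputable def krausAdj (N : ι → Matrix b a ℂ) (P : Matrix (r × b × e) (r × b) ℂ) :
    Matrix (r × a × e) (r × a) ℂ :=
  ∑ k, ((1 : Matrix r r ℂ) ⊗ₖ ((N k)ᴴ ⊗ₖ (1 : Matrix e e ℂ))) * P * ((1 : Matrix r r ℂ) ⊗ₖ N k)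

omit [Fintype a] [DecidableEq a] [DecidableEq b] in
theorem krausAdj_apply (N : ι → Matrix b a ℂ) (P : Matrix (r × b × e) (r × b) ℂ)
    (i : r × a × e) (j : r × a) :
    krausAdj N P i j = ∑ k, ∑ y, ∑ x,
      star (N k x i.2.1) * P (i.1, x, i.2.2) (j.1, y) * N k y j.2 := by
  simp only [krausAdj, Matrix.sum_apply, Matrix.mul_apply, Matrix.kroneckerMap_apply,
    Matrix.one_apply, Fintype.sum_prod_type, Matrix.conjTranspose_apply, Finset.sum_mul, ite_mul,
    mul_ite, one_mul, mul_one, zero_mul, mul_zero]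
  refine Finset.sum_congr rfl fun k _ => ?_
  rw [Finset.sum_eq_single j.1 (fun _ _ h => by simp [h]) (by simp)]
  refine Finset.sum_congr rfl fun y _ => ?_
  simp

omit [Fintype a] [DecidableEq a] [DecidableEq b] in
theorem krausAdj_add (N : ι → Matrix b a ℂ) (P Q : Matrix (r × b × e) (r × b) ℂ) :
    krausAdj N (P + Q) = krausAdj N P + krausAdj N Q := by
  simp [krausAdj, Matrix.mul_add, Matrix.add_mul, Finset.sum_add_distrib]

theorem norm_krausAdj_le (N : ι → Matrix b a ℂ) (hN : ∑ k, (N k)ᴴ * N k = 1)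
    (P : Matrix (r × b × e) (r × b) ℂ) : ‖krausAdj N P‖ ≤ ‖P‖ := by
  have hR : ∑ k, ((1 : Matrix r r ℂ) ⊗ₖ N k)ᴴ * ((1 : Matrix r r ℂ) ⊗ₖ N k) = 1 := by
    simp only [Matrix.conjTranspose_kronecker, ← Matrix.mul_kronecker_mul,
      Matrix.conjTranspose_one, mul_one]
    rw [← Matrix.one_kronecker_one, ← hN]
    ext i j
    simp [Matrix.sum_apply, Finset.mul_sum]
  have hL : ∑ k, ((1 : Matrix r r ℂ) ⊗ₖ (N k ⊗ₖ (1 : Matrix e e ℂ)))ᴴ *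
      ((1 : Matrix r r ℂ) ⊗ₖ (N k ⊗ₖ (1 : Matrix e e ℂ))) = 1 := by
    simp only [Matrix.conjTranspose_kronecker, ← Matrix.mul_kronecker_mul,
      Matrix.conjTranspose_one, mul_one]
    rw [← Matrix.one_kronecker_one, ← Matrix.one_kronecker_one, ← hN]
    ext i j
    simp [Matrix.sum_apply, Finset.mul_sum, Finset.sum_mul]
  have := norm_sum_conjTranspose_mul_mul_le _ _ P hL hR
  simp only [Matrix.conjTranspose_kronecker, Matrix.conjTranspose_one] at this
  exact this

omit [Fintype a] [DecidableEq a] [DecidableEq b] [DecidableEq c] in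
theorem krausAdj_comp (N : ι → Matrix b a ℂ) (D : κ → Matrix c b ℂ)
    (P : Matrix (r × c × e) (r × c) ℂ) :
    krausAdj N (krausAdj D P) = krausAdj (fun t : ι × κ => D t.2 * N t.1) P := by
  simp only [krausAdj, Fintype.sum_prod_type, Matrix.mul_sum, Matrix.sum_mul]
  refine Finset.sum_congr rfl fun k _ => Finset.sum_congr rfl fun n _ => ?_
  have h1 : (1 : Matrix r r ℂ) ⊗ₖ (D n * N k) =
      ((1 : Matrix r r ℂ) ⊗ₖ D n) * ((1 : Matrix r r ℂ) ⊗ₖ N k) := by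
    rw [← Matrix.mul_kronecker_mul, mul_one]
  have h2 : (1 : Matrix r r ℂ) ⊗ₖ ((D n * N k)ᴴ ⊗ₖ (1 : Matrix e e ℂ)) =
      ((1 : Matrix r r ℂ) ⊗ₖ ((N k)ᴴ ⊗ₖ (1 : Matrix e e ℂ))) *
        ((1 : Matrix r r ℂ) ⊗ₖ ((D n)ᴴ ⊗ₖ (1 : Matrix e e ℂ))) := by
    rw [← Matrix.mul_kronecker_mul, ← Matrix.mul_kronecker_mul, mul_one, mul_one,
      Matrix.conjTranspose_mul]
  rw [h1, h2]
  simp only [Matrix.mul_assoc]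

omit [Fintype a] [DecidableEq a] [DecidableEq b] in
/-- Relabelling the reference system and selecting part of the ancilla commute with the extended
adjoint. -/
theorem krausAdj_submatrix {r' : Type*} [Fintype r'] [DecidableEq r'] (N : ι → Matrix b a ℂ)
    (P : Matrix (r × b × e) (r × b) ℂ) (f : r' → r) (g : e' → e) :
    krausAdj N (P.submatrix (Prod.map f (Prod.map id g)) (Prod.map f id)) =
      (krausAdj N P).submatrix (Prod.map f (Prod.map id g)) (Prod.map f id) := by
  ext i j
  simp [krausAdj_apply]

omit [Fintype a] [DecidableEq a] [DecidableEq b] in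
/-- The tensor factor on which `N k ⊗ₖ 1` acts trivially can be absorbed into the reference. -/
theorem krausAdj_kronecker_one (N : ι → Matrix b a ℂ)
    (P : Matrix (r × (b × m) × e) (r × (b × m)) ℂ) :
    krausAdj N (P.submatrix (fun i : (r × m) × b × e => (i.1.1, (i.2.1, i.1.2), i.2.2))
        (fun j : (r × m) × b => (j.1.1, (j.2, j.1.2)))) =
      (krausAdj (fun k => N k ⊗ₖ (1 : Matrix m m ℂ)) P).submatrix
        (fun i : (r × m) × a × e => (i.1.1, (i.2.1, i.1.2), i.2.2))
        (fun j : (r × m) × a => (j.1.1, (j.2, j.1.2))) := by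
  ext i j
  simp only [krausAdj_apply, Matrix.submatrix_apply, Matrix.kroneckerMap_apply, Matrix.one_apply,
    Fintype.sum_prod_type]
  simp [apply_ite (star : ℂ → ℂ)]

/-- The matrix whose ancilla blocks are `P` and `Q`. -/
def ancillaStack (P : Matrix (r × b × e) (r × b) ℂ) (Q : Matrix (r × b × e') (r × b) ℂ) :
    Matrix (r × b × (e ⊕ e')) (r × b) ℂ :=
  Matrix.of fun i j => i.2.2.elim (fun s => P (i.1, i.2.1, s) j) (fun s => Q (i.1, i.2.1, s) j)

omit [DecidableEq r] [DecidableEq b] [DecidableEq e] [DecidableEq e'] in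
theorem conjTranspose_ancillaStack_mul (P : Matrix (r × b × e) (r × b) ℂ)
    (Q : Matrix (r × b × e') (r × b) ℂ) :
    (ancillaStack P Q)ᴴ * ancillaStack P Q = Pᴴ * P + Qᴴ * Q := by
  ext i j
  simp [ancillaStack, Matrix.mul_apply, Fintype.sum_prod_type, Finset.sum_add_distrib]

omit [Fintype a] [DecidableEq a] [DecidableEq b] in
theorem krausAdj_ancillaStack (N : ι → Matrix b a ℂ) (P : Matrix (r × b × e) (r × b) ℂ)
    (Q : Matrix (r × b × e') (r × b) ℂ) :
    krausAdj N (ancillaStack P Q) = ancillaStack (krausAdj N P) (krausAdj N Q) := by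
  ext i j
  obtain ⟨i, y, s | s⟩ := i <;> simp [ancillaStack, krausAdj_apply]

theorem norm_le_norm_ancillaStack (P : Matrix (r × b × e) (r × b) ℂ)
    (Q : Matrix (r × b × e') (r × b) ℂ) : ‖P‖ ≤ ‖ancillaStack P Q‖ :=
  norm_submatrix_le (ancillaStack P Q) (Prod.map id (Prod.map id Sum.inl)) id
    (Function.injective_id.prodMap (Function.injective_id.prodMap Sum.inl_injective))
    Function.injective_id

/-- The extended adjoint of a channel maps a jointly contractive pair to such a pair. -/
theorem krausAdj_sq_add_sq_le_one (D : ι → Matrix b a ℂ) (hD : ∑ k, (D k)ᴴ * D k = 1)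
    (P0 P1 : Matrix (r × b × e) (r × b) ℂ) (hP : P0ᴴ * P0 + P1ᴴ * P1 ≤ 1) :
    (krausAdj D P0)ᴴ * krausAdj D P0 + (krausAdj D P1)ᴴ * krausAdj D P1 ≤ 1 := by
  rw [← conjTranspose_ancillaStack_mul, conjTranspose_mul_self_le_one_iff] at hP ⊢
  rw [← krausAdj_ancillaStack]
  exact (norm_krausAdj_le D hD _).trans hP

theorem norm_le_one_of_sq_add_sq_eq_one (P0 P1 : Matrix (r × b × e) (r × b) ℂ)
    (hP : P0ᴴ * P0 + P1ᴴ * P1 = 1) : ‖P0‖ ≤ 1 := by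
  have h := (conjTranspose_mul_self_le_one_iff (ancillaStack P0 P1)).1
    (by rw [conjTranspose_ancillaStack_mul, hP])
  exact (norm_le_norm_ancillaStack P0 P1).trans h

omit [DecidableEq e] in
/-- A jointly contractive pair is completed to a normalized one by one extra ancilla level. -/
theorem exists_ancilla_completion (Q0 Q1 : Matrix (r × b × e) (r × b) ℂ)
    (hQ : Q0ᴴ * Q0 + Q1ᴴ * Q1 ≤ 1) :
    ∃ C : Matrix (r × b × Unit) (r × b) ℂ,
      (ancillaStack Q0 C)ᴴ * ancillaStack Q0 C +
        (ancillaStack Q1 (0 : Matrix (r × b × Unit) (r × b) ℂ))ᴴ *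
          ancillaStack Q1 (0 : Matrix (r × b × Unit) (r × b) ℂ) = 1 := by
  obtain ⟨C, hC⟩ := CStarAlgebra.nonneg_iff_eq_star_mul_self.1 (sub_nonneg.2 hQ)
  refine ⟨C.submatrix (fun i => (i.1, i.2.1)) id, ?_⟩
  have h : (C.submatrix (fun i : r × b × Unit => (i.1, i.2.1)) id)ᴴ *
      C.submatrix (fun i : r × b × Unit => (i.1, i.2.1)) id = star C * C := by
    ext i j
    simp [Matrix.mul_apply, Fintype.sum_prod_type, Matrix.star_apply]
  rw [conjTranspose_ancillaStack_mul, conjTranspose_ancillaStack_mul, h, ← hC,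
    Matrix.mul_zero]
  abel

end KrausAdjoint

section Discrimination

variable {ι : Type*} [Fintype ι] {dA dB : ℕ}

theorem opNorm_chAdj_add {dR dE : ℕ} (N0 N1 : ι → Matrix (Fin dB) (Fin dA) ℂ)
    (P0 P1 : Matrix (Fin dR × Fin dB × Fin dE) (Fin dR × Fin dB) ℂ) :
    opNorm (chAdj N0 P0 + chAdj N1 P1) = ‖krausAdj N0 P0 + krausAdj N1 P1‖ :=
  rfl

/-- The norms over which `pcoh` takes the supremum. -/
def discriminationNorms (N0 N1 : ι → Matrix (Fin dB) (Fin dA) ℂ) : Set ℝ :=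
  {x : ℝ | ∃ (dR dE : ℕ), 0 < dR ∧ 0 < dE ∧
    ∃ P0 P1 : Matrix (Fin dR × Fin dB × Fin dE) (Fin dR × Fin dB) ℂ,
      P0ᴴ * P0 + P1ᴴ * P1 = 1 ∧ x = opNorm (chAdj N0 P0 + chAdj N1 P1)}

theorem discriminationNorms_nonneg (N0 N1 : ι → Matrix (Fin dB) (Fin dA) ℂ) :
    ∀ x ∈ discriminationNorms N0 N1, 0 ≤ x := by
  rintro x ⟨dR, dE, -, -, P0, P1, -, rfl⟩
  exact norm_nonneg _

theorem bddAbove_discriminationNorms (N0 N1 : ι → Matrix (Fin dB) (Fin dA) ℂ)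
    (hN0 : ∑ k, (N0 k)ᴴ * N0 k = 1) (hN1 : ∑ k, (N1 k)ᴴ * N1 k = 1) :
    BddAbove (discriminationNorms N0 N1) := by
  refine ⟨1 + 1, ?_⟩
  rintro x ⟨dR, dE, -, -, P0, P1, hP, rfl⟩
  rw [opNorm_chAdj_add]
  refine (norm_add_le _ _).trans (add_le_add ?_ ?_)
  · exact (norm_krausAdj_le N0 hN0 P0).trans (norm_le_one_of_sq_add_sq_eq_one P0 P1 hP)
  · exact (norm_krausAdj_le N1 hN1 P1).trans
      (norm_le_one_of_sq_add_sq_eq_one P1 P0 (by rw [add_comm, hP]))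

theorem norm_mem_discriminationNorms {r e : Type*} [Fintype r] [Fintype e] [DecidableEq r]
    [DecidableEq e] [Nonempty r] [Nonempty e] (N0 N1 : ι → Matrix (Fin dB) (Fin dA) ℂ)
    (P0 P1 : Matrix (r × Fin dB × e) (r × Fin dB) ℂ) (hP : P0ᴴ * P0 + P1ᴴ * P1 = 1) :
    ‖krausAdj N0 P0 + krausAdj N1 P1‖ ∈ discriminationNorms N0 N1 := by
  let f := (Fintype.equivFin r).symm
  let g := (Fintype.equivFin e).symm
  let σ := f.prodCongr ((Equiv.refl (Fin dB)).prodCongr g)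
  let τ := f.prodCongr (Equiv.refl (Fin dB))
  refine ⟨Fintype.card r, Fintype.card e, Fintype.card_pos, Fintype.card_pos,
    P0.submatrix σ τ, P1.submatrix σ τ, ?_, ?_⟩
  · simp only [Matrix.conjTranspose_submatrix, Matrix.submatrix_mul_equiv]
    rw [← Matrix.submatrix_one_equiv τ, ← hP]
    rfl
  · change _ = ‖krausAdj N0 (P0.submatrix (Prod.map f (Prod.map id g)) (Prod.map f id)) +
      krausAdj N1 (P1.submatrix (Prod.map f (Prod.map id g)) (Prod.map f id))‖
    rw [krausAdj_submatrix, krausAdj_submatrix]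
    exact (norm_submatrix_equiv (krausAdj N0 P0 + krausAdj N1 P1)
      (f.prodCongr ((Equiv.refl (Fin dA)).prodCongr g)) (f.prodCongr (Equiv.refl (Fin dA)))).symm

theorem norm_le_sSup_discriminationNorms {r e : Type*} [Fintype r] [Fintype e] [DecidableEq r]
    [DecidableEq e] (N0 N1 : ι → Matrix (Fin dB) (Fin dA) ℂ)
    (hN0 : ∑ k, (N0 k)ᴴ * N0 k = 1) (hN1 : ∑ k, (N1 k)ᴴ * N1 k = 1)
    (Q0 Q1 : Matrix (r × Fin dB × e) (r × Fin dB) ℂ) (hQ : Q0ᴴ * Q0 + Q1ᴴ * Q1 ≤ 1) :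
    ‖krausAdj N0 Q0 + krausAdj N1 Q1‖ ≤ sSup (discriminationNorms N0 N1) := by
  rcases isEmpty_or_nonempty r with hr | hr
  · rw [Subsingleton.elim (krausAdj N0 Q0 + krausAdj N1 Q1) 0, norm_zero]
    exact Real.sSup_nonneg (discriminationNorms_nonneg N0 N1)
  · obtain ⟨C, hC⟩ := exists_ancilla_completion Q0 Q1 hQ
    refine le_trans ?_ (le_csSup (bddAbove_discriminationNorms N0 N1 hN0 hN1)
      (norm_mem_discriminationNorms N0 N1 _ _ hC))
    rw [krausAdj_ancillaStack, krausAdj_ancillaStack]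
    refine (norm_le_norm_ancillaStack _ (krausAdj N0 C + krausAdj N1 0)).trans_eq ?_
    congr 1
    ext ⟨i, y, s | s⟩ j <;> rfl

theorem norm_krausAdj_kronecker_one_le {r e m : Type*} [Fintype r] [Fintype e] [Fintype m]
    [DecidableEq r] [DecidableEq e] [DecidableEq m] (N0 N1 : ι → Matrix (Fin dB) (Fin dA) ℂ)
    (hN0 : ∑ k, (N0 k)ᴴ * N0 k = 1) (hN1 : ∑ k, (N1 k)ᴴ * N1 k = 1)
    (Q0 Q1 : Matrix (r × (Fin dB × m) × e) (r × (Fin dB × m)) ℂ)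
    (hQ : Q0ᴴ * Q0 + Q1ᴴ * Q1 ≤ 1) :
    ‖krausAdj (fun k => N0 k ⊗ₖ (1 : Matrix m m ℂ)) Q0 +
        krausAdj (fun k => N1 k ⊗ₖ (1 : Matrix m m ℂ)) Q1‖ ≤
      sSup (discriminationNorms N0 N1) := by
  let σ (x : Type) : (r × m) × x × e ≃ r × (x × m) × e :=
    ⟨fun i => (i.1.1, (i.2.1, i.1.2), i.2.2), fun i => ((i.1, i.2.1.2), i.2.1.1, i.2.2),
      fun _ => rfl, fun _ => rfl⟩
  let τ (x : Type) : (r × m) × x ≃ r × (x × m) :=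
    ⟨fun j => (j.1.1, (j.2, j.1.2)), fun j => ((j.1, j.2.2), j.2.1), fun _ => rfl, fun _ => rfl⟩
  have hQ' : (Q0.submatrix (σ (Fin dB)) (τ (Fin dB)))ᴴ * Q0.submatrix (σ (Fin dB)) (τ (Fin dB)) +
      (Q1.submatrix (σ (Fin dB)) (τ (Fin dB)))ᴴ * Q1.submatrix (σ (Fin dB)) (τ (Fin dB)) ≤ 1 := by
    simp only [Matrix.conjTranspose_submatrix, Matrix.submatrix_mul_equiv]
    rw [← Matrix.submatrix_one_equiv (τ (Fin dB))]
    exact Matrix.PosSemidef.submatrix hQ (τ (Fin dB))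
  refine le_trans (le_of_eq ?_) (norm_le_sSup_discriminationNorms N0 N1 hN0 hN1 _ _ hQ')
  have h (N : ι → Matrix (Fin dB) (Fin dA) ℂ)
      (Q : Matrix (r × (Fin dB × m) × e) (r × (Fin dB × m)) ℂ) :
      krausAdj N (Q.submatrix (σ (Fin dB)) (τ (Fin dB))) =
        (krausAdj (fun k => N k ⊗ₖ (1 : Matrix m m ℂ)) Q).submatrix (σ (Fin dA)) (τ (Fin dA)) :=
    krausAdj_kronecker_one N Q
  rw [h, h]
  exact (norm_submatrix_equiv (krausAdj (fun k => N0 k ⊗ₖ (1 : Matrix m m ℂ)) Q0 +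
    krausAdj (fun k => N1 k ⊗ₖ (1 : Matrix m m ℂ)) Q1) (σ (Fin dA)) (τ (Fin dA))).symm

end Discrimination

/-- The extended adjoint of a channel transformed by a superchannel. -/
theorem krausAdj_superchannel {ι κ μ r a b c d m e : Type*} [Fintype ι] [Fintype κ] [Fintype μ]
    [Fintype r] [Fintype a] [Fintype b] [Fintype c] [Fintype d] [Fintype m] [Fintype e]
    [DecidableEq r] [DecidableEq m] [DecidableEq e] (N : ι → Matrix b a ℂ)
    (E : κ → Matrix (a × m) c ℂ) (D : μ → Matrix d (b × m) ℂ)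
    (P : Matrix (r × d × e) (r × d) ℂ) :
    krausAdj (fun t : ι × κ × μ => D t.2.2 * ((N t.1 ⊗ₖ (1 : Matrix m m ℂ)) * E t.2.1)) P =
      krausAdj E (krausAdj (fun k => N k ⊗ₖ (1 : Matrix m m ℂ)) (krausAdj D P)) := by
  rw [krausAdj_comp, krausAdj_comp]
  simp only [krausAdj]
  let σ : ι × κ × μ ≃ (κ × ι) × μ :=
    ⟨fun t => ((t.2.1, t.1), t.2.2), fun t => (t.1.2, t.1.1, t.2), fun _ => rfl, fun _ => rfl⟩
  rw [← σ.sum_comp]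
  refine Finset.sum_congr rfl fun t _ => ?_
  simp only [σ, Equiv.coe_fn_mk, Matrix.mul_assoc]

/-- Theorem 1 (non-increase under a quantum superchannel): if the superchannel `Θ` is realized
by a pre-processing channel with Kraus operators `E m` and a post-processing channel with
Kraus operators `D n`, so that `Θ(Nⁱ)` has Kraus operators `D n (Nⁱ k ⊗ I_M) E m`, then
`p_coh(Θ(N⁰), Θ(N¹)) ≤ p_coh(N⁰, N¹)`. -/
theorem pcoh_superchannel_le {dA dB dC dD dM K KE KD : ℕ}
    (N0 N1 : Fin K → Matrix (Fin dB) (Fin dA) ℂ)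
    (hN0 : ∑ k, (N0 k)ᴴ * N0 k = 1) (hN1 : ∑ k, (N1 k)ᴴ * N1 k = 1)
    (E : Fin KE → Matrix (Fin dA × Fin dM) (Fin dC) ℂ)
    (hE : ∑ m, (E m)ᴴ * E m = 1)
    (D : Fin KD → Matrix (Fin dD) (Fin dB × Fin dM) ℂ)
    (hD : ∑ n, (D n)ᴴ * D n = 1) :
    pcoh
      (fun t : Fin K × Fin KE × Fin KD =>
        D t.2.2 * ((N0 t.1 ⊗ₖ (1 : Matrix (Fin dM) (Fin dM) ℂ)) * E t.2.1))
      (fun t : Fin K × Fin KE × Fin KD =>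
        D t.2.2 * ((N1 t.1 ⊗ₖ (1 : Matrix (Fin dM) (Fin dM) ℂ)) * E t.2.1)) ≤
    pcoh N0 N1 := by
  have key : ∀ x ∈ discriminationNorms
      (fun t : Fin K × Fin KE × Fin KD =>
        D t.2.2 * ((N0 t.1 ⊗ₖ (1 : Matrix (Fin dM) (Fin dM) ℂ)) * E t.2.1))
      (fun t : Fin K × Fin KE × Fin KD =>
        D t.2.2 * ((N1 t.1 ⊗ₖ (1 : Matrix (Fin dM) (Fin dM) ℂ)) * E t.2.1)),
      x ≤ sSup (discriminationNorms N0 N1) := by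
    rintro x ⟨dR, dE, -, -, P0, P1, hP, rfl⟩
    rw [opNorm_chAdj_add, krausAdj_superchannel, krausAdj_superchannel, ← krausAdj_add]
    exact (norm_krausAdj_le E hE _).trans (norm_krausAdj_kronecker_one_le N0 N1 hN0 hN1 _ _
      (krausAdj_sq_add_sq_le_one D hD P0 P1 hP.le))
  have hnonneg := Real.sSup_nonneg (discriminationNorms_nonneg N0 N1)
  refine pow_le_pow_left₀ (mul_nonneg (by norm_num) (Real.sSup_nonneg
    (discriminationNorms_nonneg _ _))) (mul_le_mul_of_nonneg_left ?_ (by norm_num)) 2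
  exact Real.sSup_le key hnonneg
end

section
/- Second inequality of the chain relating success probabilities: for quantum channels N⁰ and N¹ from A (dimension d_A) to B (dimension d_B) with Kraus operators {N_k⁰}_{k=1}^K and {N_k¹}_{k=1}^K, it holds that p_incunc(N⁰, N¹) ≤ p_inc(N⁰, N¹). -/
open scoped Kronecker Matrix ComplexOrder

/-- The success probability of incoherent channel discrimination with uncomputing,
`p_incunc(N⁰,N¹) = (1/2) · sup ‖ (N⁰†(P⁰))† N⁰†(P⁰) + (N¹†(P¹))† N¹†(P¹) ‖`, supremum over
positive integers `d_R, d_E'` and matrices `P⁰, P¹` with `P⁰ᴴP⁰ + P¹ᴴP¹ = I`. -/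
noncomputable def pincunc {dA dB : ℕ} {ι : Type*} [Fintype ι]
    (N0 N1 : ι → Matrix (Fin dB) (Fin dA) ℂ) : ℝ :=
  (1/2) * sSup {x : ℝ | ∃ (dR dE : ℕ), 0 < dR ∧ 0 < dE ∧
    ∃ P0 P1 : Matrix (Fin dR × Fin dB × Fin dE) (Fin dR × Fin dB) ℂ,
      P0ᴴ * P0 + P1ᴴ * P1 = 1 ∧
      x = opNorm ((chAdj N0 P0)ᴴ * chAdj N0 P0 + (chAdj N1 P1)ᴴ * chAdj N1 P1)}

/-- The incoherent-discrimination success probability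
`p_inc(N⁰,N¹) = (1/2) · sup ‖ ∑ₖ (I⊗N⁰ₖ)† Λ⁰ (I⊗N⁰ₖ) + ∑ₖ (I⊗N¹ₖ)† Λ¹ (I⊗N¹ₖ) ‖`,
supremum over positive integers `d_R` and positive semidefinite `Λ⁰, Λ¹` with `Λ⁰ + Λ¹ = I`. -/
noncomputable def pinc {dA dB : ℕ} {ι : Type*} [Fintype ι]
    (N0 N1 : ι → Matrix (Fin dB) (Fin dA) ℂ) : ℝ :=
  (1/2) * sSup {x : ℝ | ∃ (dR : ℕ), 0 < dR ∧
    ∃ L0 L1 : Matrix (Fin dR × Fin dB) (Fin dR × Fin dB) ℂ,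
      L0.PosSemidef ∧ L1.PosSemidef ∧ L0 + L1 = 1 ∧
      x = opNorm
        (∑ k, ((1 : Matrix (Fin dR) (Fin dR) ℂ) ⊗ₖ N0 k)ᴴ * L0 *
            ((1 : Matrix (Fin dR) (Fin dR) ℂ) ⊗ₖ N0 k) +
         ∑ k, ((1 : Matrix (Fin dR) (Fin dR) ℂ) ⊗ₖ N1 k)ᴴ * L1 *
            ((1 : Matrix (Fin dR) (Fin dR) ℂ) ⊗ₖ N1 k))}

open scoped Matrix.Norms.L2Operator in
/-- The operator norm of a matrix is its norm in the C⋆-algebra of matrices. -/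
lemma opNorm_eq_norm {n : Type*} [Fintype n] [DecidableEq n] (M : Matrix n n ℂ) :
    opNorm M = ‖M‖ := rfl

open scoped Matrix.Norms.L2Operator MatrixOrder in
/-- The operator norm is monotone on positive semidefinite matrices. -/
lemma opNorm_le_opNorm_of_posSemidef {n : Type*} [Fintype n] [DecidableEq n]
    {A B : Matrix n n ℂ} (hA : A.PosSemidef) (hAB : (B - A).PosSemidef) :
    opNorm A ≤ opNorm B := by
  let _ : CStarAlgebra (Matrix n n ℂ) := {}
  rw [opNorm_eq_norm, opNorm_eq_norm]
  exact CStarAlgebra.norm_le_norm_of_nonneg_of_le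
    (Matrix.nonneg_iff_posSemidef.mpr hA) (Matrix.le_iff.mpr hAB)

lemma opNorm_nonneg {m n : Type*} [Fintype m] [Fintype n] [DecidableEq n]
    (M : Matrix m n ℂ) : 0 ≤ opNorm M := norm_nonneg _

/-- Kadison–Schwarz type inequality for `X = ∑ₖ Cₖᴴ P Aₖ` with `∑ₖ Cₖᴴ Cₖ = 1`. -/
lemma posSemidef_sum_conj_sub {ι a b c d : Type*} [Fintype ι] [Fintype a] [Fintype b]
    [Fintype c] [Fintype d] [DecidableEq d]
    (A : ι → Matrix b a ℂ) (C : ι → Matrix c d ℂ) (P : Matrix c b ℂ)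
    (hC : ∑ k, (C k)ᴴ * C k = 1) :
    (∑ k, (A k)ᴴ * (Pᴴ * P) * A k -
      (∑ k, (C k)ᴴ * P * A k)ᴴ * ∑ k, (C k)ᴴ * P * A k).PosSemidef := by
  set X := ∑ k, (C k)ᴴ * P * A k with hX
  have hXX : ∑ k, (C k * X)ᴴ * (P * A k) = Xᴴ * X := by
    conv_rhs => rhs; rw [hX]
    simp only [Matrix.mul_sum, Matrix.conjTranspose_mul, Matrix.mul_assoc]
  have hXX' : ∑ k, (P * A k)ᴴ * (C k * X) = Xᴴ * X := by
    simpa [Matrix.conjTranspose_sum, Matrix.conjTranspose_mul, Matrix.mul_assoc]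
      using congrArg Matrix.conjTranspose hXX
  have hCX : ∑ k, (C k * X)ᴴ * (C k * X) = Xᴴ * X := by
    have h : ∀ k, (C k * X)ᴴ * (C k * X) = Xᴴ * ((C k)ᴴ * C k) * X := fun k => by
      simp only [Matrix.conjTranspose_mul, Matrix.mul_assoc]
    simp only [h, ← Matrix.sum_mul, ← Matrix.mul_sum, hC, Matrix.mul_one]
  have hPA : ∑ k, (P * A k)ᴴ * (P * A k) = ∑ k, (A k)ᴴ * (Pᴴ * P) * A k := by
    simp only [Matrix.conjTranspose_mul, Matrix.mul_assoc]
  have key : ∑ k, (A k)ᴴ * (Pᴴ * P) * A k - Xᴴ * X =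
      ∑ k, (P * A k - C k * X)ᴴ * (P * A k - C k * X) := by
    simp only [Matrix.conjTranspose_sub, Matrix.sub_mul, Matrix.mul_sub,
      Finset.sum_sub_distrib, hXX, hXX', hCX, hPA]
    abel
  rw [key]
  exact Matrix.posSemidef_sum _ fun k _ => Matrix.posSemidef_conjTranspose_mul_self _

/-- The Kraus operators `I ⊗ Nₖ` satisfy the normalization of the `Nₖ`. -/
lemma sum_conjTranspose_one_kronecker_mul {ι r a b : Type*} [Fintype ι] [Fintype r]
    [DecidableEq r] [Fintype b] [DecidableEq a]
    {N : ι → Matrix b a ℂ} (hN : ∑ k, (N k)ᴴ * N k = 1) :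
    ∑ k, ((1 : Matrix r r ℂ) ⊗ₖ N k)ᴴ * ((1 : Matrix r r ℂ) ⊗ₖ N k) = 1 := by
  simp only [Matrix.conjTranspose_kronecker, Matrix.conjTranspose_one,
    ← Matrix.mul_kronecker_mul, Matrix.one_mul]
  rw [← Matrix.one_kronecker_one, ← hN]
  ext i j
  simp [Matrix.sum_apply, Finset.mul_sum]

/-- The Kraus operators `Nₖ ⊗ I` satisfy the normalization of the `Nₖ`. -/
lemma sum_conjTranspose_kronecker_one_mul {ι r a b : Type*} [Fintype ι] [Fintype r]
    [DecidableEq r] [Fintype b] [DecidableEq a]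
    {N : ι → Matrix b a ℂ} (hN : ∑ k, (N k)ᴴ * N k = 1) :
    ∑ k, (N k ⊗ₖ (1 : Matrix r r ℂ))ᴴ * (N k ⊗ₖ (1 : Matrix r r ℂ)) = 1 := by
  simp only [Matrix.conjTranspose_kronecker, Matrix.conjTranspose_one,
    ← Matrix.mul_kronecker_mul, Matrix.one_mul]
  rw [← Matrix.one_kronecker_one, ← hN]
  ext i j
  simp [Matrix.sum_apply, Finset.sum_mul]

/-- `N†(P)ᴴ N†(P) ≤ N†(Pᴴ P)` in the Loewner order. -/
lemma posSemidef_sub_chAdj {dA dB dR dE : ℕ} {ι : Type*} [Fintype ι]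
    {N : ι → Matrix (Fin dB) (Fin dA) ℂ} (hN : ∑ k, (N k)ᴴ * N k = 1)
    (P : Matrix (Fin dR × Fin dB × Fin dE) (Fin dR × Fin dB) ℂ) :
    (∑ k, ((1 : Matrix (Fin dR) (Fin dR) ℂ) ⊗ₖ N k)ᴴ * (Pᴴ * P) *
        ((1 : Matrix (Fin dR) (Fin dR) ℂ) ⊗ₖ N k) -
      (chAdj N P)ᴴ * chAdj N P).PosSemidef := by
  have h := posSemidef_sum_conj_sub
    (fun k => (1 : Matrix (Fin dR) (Fin dR) ℂ) ⊗ₖ N k)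
    (fun k => (1 : Matrix (Fin dR) (Fin dR) ℂ) ⊗ₖ (N k ⊗ₖ (1 : Matrix (Fin dE) (Fin dE) ℂ)))
    P (sum_conjTranspose_one_kronecker_mul (sum_conjTranspose_kronecker_one_mul hN))
  simpa only [chAdj, Matrix.conjTranspose_kronecker, Matrix.conjTranspose_one] using h

/-- `∑ₖ Aₖᴴ L Aₖ ≤ 1` whenever `∑ₖ Aₖᴴ Aₖ = 1` and `L ≤ 1`. -/
lemma posSemidef_one_sub_sum_conj {ι a b : Type*} [Fintype ι] [Fintype a] [Fintype b]
    [DecidableEq a] [DecidableEq b] {A : ι → Matrix b a ℂ} (hA : ∑ k, (A k)ᴴ * A k = 1)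
    {L : Matrix b b ℂ} (hL : (1 - L).PosSemidef) :
    (1 - ∑ k, (A k)ᴴ * L * A k).PosSemidef := by
  have h : 1 - ∑ k, (A k)ᴴ * L * A k = ∑ k, (A k)ᴴ * (1 - L) * A k := by
    simp only [Matrix.mul_sub, Matrix.sub_mul, Matrix.mul_one, Finset.sum_sub_distrib, hA]
  rw [h]
  exact Matrix.posSemidef_sum _ fun k _ => hL.conjTranspose_mul_mul_same _

open scoped Matrix.Norms.L2Operator in
lemma opNorm_one_add_one_le {n : Type*} [Fintype n] [DecidableEq n] :
    opNorm (1 + 1 : Matrix n n ℂ) ≤ 2 := by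
  have h : ‖(1 : Matrix n n ℂ)‖ ≤ 1 := by
    refine ContinuousLinearMap.opNorm_le_bound _ zero_le_one fun v => ?_
    simp
  rw [opNorm_eq_norm]
  exact (norm_add_le _ _).trans (by linarith)

/-- Second inequality of the chain: `p_incunc(N⁰,N¹) ≤ p_inc(N⁰,N¹)`. -/
theorem pincunc_le_pinc {dA dB K : ℕ} (N0 N1 : Fin K → Matrix (Fin dB) (Fin dA) ℂ)
    (hN0 : ∑ k, (N0 k)ᴴ * N0 k = 1) (hN1 : ∑ k, (N1 k)ᴴ * N1 k = 1) :
    pincunc N0 N1 ≤ pinc N0 N1 := by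
  unfold pincunc pinc
  refine mul_le_mul_of_nonneg_left (Real.sSup_le ?_ (Real.sSup_nonneg ?_)) (by norm_num)
  · rintro x ⟨dR, dE, hR, -, P0, P1, hP, rfl⟩
    have hsub := (posSemidef_sub_chAdj hN0 P0).add (posSemidef_sub_chAdj hN1 P1)
    rw [← add_sub_add_comm] at hsub
    have hle := opNorm_le_opNorm_of_posSemidef
      ((Matrix.posSemidef_conjTranspose_mul_self _).add
        (Matrix.posSemidef_conjTranspose_mul_self _)) hsub
    refine hle.trans (le_csSup ⟨2, ?_⟩ ⟨dR, hR, P0ᴴ * P0, P1ᴴ * P1,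
      Matrix.posSemidef_conjTranspose_mul_self _,
      Matrix.posSemidef_conjTranspose_mul_self _, hP, rfl⟩)
    rintro x ⟨dR, -, L0, L1, hL0, hL1, hL, rfl⟩
    refine (opNorm_le_opNorm_of_posSemidef (B := 1 + 1) ?_ ?_).trans opNorm_one_add_one_le
    · exact (Matrix.posSemidef_sum _ fun k _ => hL0.conjTranspose_mul_mul_same _).add
        (Matrix.posSemidef_sum _ fun k _ => hL1.conjTranspose_mul_mul_same _)
    · rw [add_sub_add_comm]
      refine (posSemidef_one_sub_sum_conj (sum_conjTranspose_one_kronecker_mul hN0) ?_).add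
        (posSemidef_one_sub_sum_conj (sum_conjTranspose_one_kronecker_mul hN1) ?_)
      · rwa [← hL, add_sub_cancel_left]
      · rwa [← hL, add_sub_cancel_right]
  · rintro x ⟨dR, -, L0, L1, -, -, -, rfl⟩
    exact opNorm_nonneg _
end
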